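/- arXiv:2510.17091 — 2 statements merged into one kernel-verified Lean document; each statement's English description precedes it below -/
import Mathlib

section
/- Let n ≥ 2, let U₀ be a nonempty open connected subset of the unit sphere S^{n−1} ⊆ ℝⁿ, let ε ∈ (0,1], and let U := { x ∈ ℝⁿ : 1 < |x| < 1+ε and x/|x| ∈ U₀ }. Then for all x, y ∈ U: max{ d_{U₀}(x/|x|, y/|y|), | |x| − |y| | } ≤ d_U(x,y) ≤ 4·max{ d_{U₀}(x/|x|, y/|y|), | |x| − |y| | }, where d_U and d_{U₀} denote the intrinsic distances of U and U₀ respectively (measured via Euclidean lengths of paths contained in the set). -/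
open Real MeasureTheory

/-- The intrinsic (geodesic) distance in `U`: the infimum of lengths of continuous paths
joining `x` to `y` within `U`. -/
noncomputable def intrinsicDist {X : Type*} [MetricSpace X] (U : Set X) (x y : X) : ℝ :=
  sInf {L : ℝ | ∃ γ : ℝ → X, ContinuousOn γ (Set.Icc 0 1) ∧ γ 0 = x ∧ γ 1 = y ∧
    (∀ t ∈ Set.Icc (0 : ℝ) 1, γ t ∈ U) ∧ eVariationOn γ (Set.Icc 0 1) ≠ ⊤ ∧
    L = (eVariationOn γ (Set.Icc 0 1)).toReal}

/-- The diameter of `U` with respect to the intrinsic distance. -/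
noncomputable def intrinsicDiam {X : Type*} [MetricSpace X] (U : Set X) : ℝ :=
  sSup {d : ℝ | ∃ x ∈ U, ∃ y ∈ U, d = intrinsicDist U x y}

/-- `U` is `(C₀, c₀)`-inner uniform: any two points of `U` are joined by a path in `U`
of length at most `C₀` times their intrinsic distance, every point `z` of which satisfies
`dist (z, ∂U) ≥ c₀ · d_U(x,z) · d_U(y,z) / d_U(x,y)`. -/
def InnerUniform {X : Type*} [MetricSpace X] (U : Set X) (C₀ c₀ : ℝ) : Prop :=
  ∀ x ∈ U, ∀ y ∈ U, ∃ γ : ℝ → X, ContinuousOn γ (Set.Icc 0 1) ∧ γ 0 = x ∧ γ 1 = y ∧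
    (∀ t ∈ Set.Icc (0 : ℝ) 1, γ t ∈ U) ∧
    (eVariationOn γ (Set.Icc 0 1)).toReal ≤ C₀ * intrinsicDist U x y ∧
    eVariationOn γ (Set.Icc 0 1) ≠ ⊤ ∧
    ∀ t ∈ Set.Icc (0 : ℝ) 1,
      c₀ * intrinsicDist U x (γ t) * intrinsicDist U y (γ t) / intrinsicDist U x y ≤
        Metric.infDist (γ t) (frontier U)

/-- The points `x` and `y` are joined by a path of finite length within `U`. -/
def RectifiablyJoined {X : Type*} [MetricSpace X] (U : Set X) (x y : X) : Prop :=
  ∃ γ : ℝ → X, ContinuousOn γ (Set.Icc 0 1) ∧ γ 0 = x ∧ γ 1 = y ∧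
    (∀ t ∈ Set.Icc (0 : ℝ) 1, γ t ∈ U) ∧ eVariationOn γ (Set.Icc 0 1) ≠ ⊤

section Variation

variable {α E F G : Type*} [LinearOrder α] [PseudoEMetricSpace E] [PseudoEMetricSpace F]
  [PseudoEMetricSpace G]

theorem eVariationOn_le_mul_add_mul {f : α → E} {g : α → F} {h : α → G} {s : Set α}
    {C D : ENNReal}
    (hle : ∀ x ∈ s, ∀ y ∈ s,
      edist (f x) (f y) ≤ C * edist (g x) (g y) + D * edist (h x) (h y)) :
    eVariationOn f s ≤ C * eVariationOn g s + D * eVariationOn h s := by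
  refine iSup_le fun ⟨n, u, hu, us⟩ => ?_
  calc ∑ i ∈ Finset.range n, edist (f (u (i + 1))) (f (u i))
      ≤ ∑ i ∈ Finset.range n, (C * edist (g (u (i + 1))) (g (u i)) +
          D * edist (h (u (i + 1))) (h (u i))) :=
        Finset.sum_le_sum fun i _ => hle _ (us _) _ (us _)
    _ = C * ∑ i ∈ Finset.range n, edist (g (u (i + 1))) (g (u i)) +
          D * ∑ i ∈ Finset.range n, edist (h (u (i + 1))) (h (u i)) := by
        rw [Finset.sum_add_distrib, Finset.mul_sum, Finset.mul_sum]
    _ ≤ _ := by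
        gcongr
        · exact eVariationOn.sum_le hu us
        · exact eVariationOn.sum_le hu us

end Variation

section IntrinsicDist

variable {X : Type*} [MetricSpace X] {U : Set X} {x y z : X}

theorem intrinsicDist_le_of_path {γ : ℝ → X} (hc : ContinuousOn γ (Set.Icc 0 1))
    (h0 : γ 0 = x) (h1 : γ 1 = y) (hU : ∀ t ∈ Set.Icc (0 : ℝ) 1, γ t ∈ U)
    (hv : eVariationOn γ (Set.Icc 0 1) ≠ ⊤) :
    intrinsicDist U x y ≤ (eVariationOn γ (Set.Icc 0 1)).toReal := by
  refine csInf_le ⟨0, ?_⟩ ⟨γ, hc, h0, h1, hU, hv, rfl⟩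
  rintro _ ⟨_, _, _, _, _, _, rfl⟩
  exact ENNReal.toReal_nonneg

theorem le_intrinsicDist (hj : RectifiablyJoined U x y) {c : ℝ}
    (h : ∀ γ : ℝ → X, ContinuousOn γ (Set.Icc 0 1) → γ 0 = x → γ 1 = y →
      (∀ t ∈ Set.Icc (0 : ℝ) 1, γ t ∈ U) → eVariationOn γ (Set.Icc 0 1) ≠ ⊤ →
      c ≤ (eVariationOn γ (Set.Icc 0 1)).toReal) :
    c ≤ intrinsicDist U x y := by
  obtain ⟨γ, hc, h0, h1, hU, hv⟩ := hj
  refine le_csInf ⟨_, γ, hc, h0, h1, hU, hv, rfl⟩ ?_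
  rintro _ ⟨γ', hc', h0', h1', hU', hv', rfl⟩
  exact h γ' hc' h0' h1' hU' hv'

theorem RectifiablyJoined.symm (h : RectifiablyJoined U x y) : RectifiablyJoined U y x := by
  obtain ⟨γ, hc, h0, h1, hU, hv⟩ := h
  have hm : Set.MapsTo (fun t : ℝ => 1 - t) (Set.Icc 0 1) (Set.Icc 0 1) := fun t ht =>
    ⟨by linarith [ht.2], by linarith [ht.1]⟩
  refine ⟨γ ∘ fun t => 1 - t, hc.comp (by fun_prop) hm, by simp [h1], by simp [h0],
    fun t ht => hU _ (hm ht), ?_⟩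
  exact ne_top_of_le_ne_top hv <| eVariationOn.comp_le_of_antitoneOn γ _
    (fun a _ b _ hab => sub_le_sub_left hab 1) hm

theorem RectifiablyJoined.trans (hxy : RectifiablyJoined U x y) (hyz : RectifiablyJoined U y z) :
    RectifiablyJoined U x z := by
  obtain ⟨γ, hc, h0, h1, hU, hv⟩ := hxy
  obtain ⟨δ, dc, d0, d1, dU, dv⟩ := hyz
  let η : ℝ → X := fun t => if t ≤ 1 / 2 then γ (2 * t) else δ (2 * t - 1)
  have hm : Set.MapsTo (fun t : ℝ => 2 * t) (Set.Icc 0 (1 / 2)) (Set.Icc 0 1) := fun t ht =>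
    ⟨by linarith [ht.1], by linarith [ht.2]⟩
  have dm : Set.MapsTo (fun t : ℝ => 2 * t - 1) (Set.Icc (1 / 2) 1) (Set.Icc 0 1) := fun t ht =>
    ⟨by linarith [ht.1], by linarith [ht.2]⟩
  have hη : Set.EqOn η (γ ∘ fun t => 2 * t) (Set.Icc 0 (1 / 2)) := fun t ht => if_pos ht.2
  have dη : Set.EqOn η (δ ∘ fun t => 2 * t - 1) (Set.Icc (1 / 2) 1) := fun t ht => by
    rcases ht.1.eq_or_lt with rfl | hlt
    · simp [η, h1, d0]
    · exact if_neg hlt.not_ge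
  have hunion : Set.Icc (0 : ℝ) (1 / 2) ∪ Set.Icc (1 / 2) 1 = Set.Icc 0 1 :=
    Set.Icc_union_Icc_eq_Icc (by norm_num) (by norm_num)
  refine ⟨η, ?_, ?_, ?_, ?_, ?_⟩
  · rw [← hunion]
    exact ((hc.comp (by fun_prop) hm).congr hη).union_of_isClosed
      ((dc.comp (by fun_prop) dm).congr dη) isClosed_Icc isClosed_Icc
  · simp [η, h0]
  · rw [dη ⟨by norm_num, le_rfl⟩]
    norm_num [d1]
  · intro t ht
    rw [← hunion] at ht
    rcases ht with ht | ht
    · rw [hη ht]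
      exact hU _ (hm ht)
    · rw [dη ht]
      exact dU _ (dm ht)
  · rw [← hunion, eVariationOn.union η (isGreatest_Icc (by norm_num)) (isLeast_Icc (by norm_num)),
      eVariationOn.congr hη, eVariationOn.congr dη]
    refine ENNReal.add_ne_top.2 ⟨ne_top_of_le_ne_top hv ?_, ne_top_of_le_ne_top dv ?_⟩
    · exact eVariationOn.comp_le_of_monotoneOn γ _ (fun a _ b _ hab => by simpa using hab) hm
    · exact eVariationOn.comp_le_of_monotoneOn δ _ (fun a _ b _ hab => by simpa using hab) dm

end IntrinsicDist

section Sphere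

variable {E : Type*} [NormedAddCommGroup E] [InnerProductSpace ℝ E]

theorem mul_norm_inv_norm_smul_sub_le {a b : E} {c : ℝ} (hc : 0 < c) (ha : c ≤ ‖a‖)
    (hb : c ≤ ‖b‖) : c * ‖‖a‖⁻¹ • a - ‖b‖⁻¹ • b‖ ≤ ‖a - b‖ := by
  have ha0 : 0 < ‖a‖ := hc.trans_le ha
  have hb0 : 0 < ‖b‖ := hc.trans_le hb
  refine le_of_sq_le_sq ?_ (norm_nonneg _)
  have hin : inner ℝ a b ≤ ‖a‖ * ‖b‖ := real_inner_le_norm a b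
  rw [mul_pow, norm_sub_sq_real, norm_sub_sq_real, norm_smul, norm_smul, inner_smul_left,
    inner_smul_right, norm_inv, norm_inv, norm_norm, norm_norm, inv_mul_cancel₀ ha0.ne',
    inv_mul_cancel₀ hb0.ne']
  set k : ℝ := ‖a‖⁻¹ * (‖b‖⁻¹ * inner ℝ a b) with hk
  have hik : inner ℝ a b = ‖a‖ * ‖b‖ * k := by rw [hk]; field_simp
  have hk1 : k ≤ 1 := by
    rw [hik] at hin
    exact le_of_mul_le_mul_left (by linarith) (mul_pos ha0 hb0)
  have hcc : c * c ≤ ‖a‖ * ‖b‖ := mul_le_mul ha hb hc.le ha0.le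
  rw [conj_trivial, ← hk, hik]
  nlinarith [sq_nonneg (‖a‖ - ‖b‖), mul_le_mul_of_nonneg_right hcc (sub_nonneg.2 hk1)]

theorem norm_inv_norm_smul_sub_le {z p : E} (hz : z ≠ 0) (hp : ‖p‖ = 1) :
    ‖‖z‖⁻¹ • z - p‖ ≤ 2 * ‖z - p‖ := by
  have h1 : ‖‖z‖⁻¹ • z - z‖ = |‖p‖ - ‖z‖| := by
    have h0 : ‖z‖ ≠ 0 := norm_ne_zero_iff.2 hz
    have : ‖z‖⁻¹ • z - z = (‖z‖⁻¹ - 1) • z := by rw [sub_smul, one_smul]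
    rw [this, norm_smul, Real.norm_eq_abs, ← abs_norm z, ← abs_mul, abs_norm, sub_mul,
      inv_mul_cancel₀ h0, hp, one_mul]
  have h2 := abs_norm_sub_norm_le p z
  rw [norm_sub_rev p z] at h2
  linarith [norm_sub_le_norm_sub_add_norm_sub (‖z‖⁻¹ • z) z p]

theorem rectifiablyJoined_of_dist_lt {V : Set E} {p q : E} {r : ℝ}
    (hr : Metric.ball p r ⊆ V) (hp : ‖p‖ = 1) (hq : ‖q‖ = 1) (h1 : ‖q - p‖ ≤ 1 / 2)
    (h2 : 2 * ‖q - p‖ < r) : RectifiablyJoined (V ∩ Metric.sphere 0 1) p q := by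
  let σ : ℝ → E := fun t => p + t • (q - p)
  have hσ : ∀ t ∈ Set.Icc (0 : ℝ) 1, ‖σ t - p‖ ≤ ‖q - p‖ := fun t ht => by
    simp only [σ, add_sub_cancel_left, norm_smul, Real.norm_eq_abs, abs_of_nonneg ht.1]
    exact mul_le_of_le_one_left (norm_nonneg _) ht.2
  have hσn : ∀ t ∈ Set.Icc (0 : ℝ) 1, 1 / 2 ≤ ‖σ t‖ := fun t ht => by
    have := norm_sub_norm_le p (σ t)
    rw [norm_sub_rev] at this
    linarith [hσ t ht]
  have hσ0 : ∀ t ∈ Set.Icc (0 : ℝ) 1, σ t ≠ 0 := fun t ht h => by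
    have := hσn t ht
    rw [h, norm_zero] at this
    linarith
  refine ⟨fun t => ‖σ t‖⁻¹ • σ t, ?_, by simp [σ, hp], by simp [σ, hq], ?_, ?_⟩
  · have hc : Continuous σ := by fun_prop
    exact (hc.norm.continuousOn.inv₀ fun t ht => norm_ne_zero_iff.2 (hσ0 t ht)).smul
      hc.continuousOn
  · refine fun t ht => ⟨hr ?_, ?_⟩
    · rw [mem_ball_iff_norm]
      linarith [norm_inv_norm_smul_sub_le (hσ0 t ht) hp, hσ t ht]
    · simp [norm_smul, hσ0 t ht]
  · have hle : eVariationOn (fun t => ‖σ t‖⁻¹ • σ t) (Set.Icc 0 1) ≤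
        1 * eVariationOn (id : ℝ → ℝ) (Set.Icc 0 1) +
          0 * eVariationOn (id : ℝ → ℝ) (Set.Icc 0 1) := by
      refine eVariationOn_le_mul_add_mul fun s hs t ht => ?_
      rw [zero_mul, add_zero, one_mul, edist_dist, edist_dist]
      refine ENNReal.ofReal_le_ofReal ?_
      have h := mul_norm_inv_norm_smul_sub_le (by norm_num) (hσn s hs) (hσn t ht)
      have h' : ‖σ s - σ t‖ = |s - t| * ‖q - p‖ := by
        rw [show σ s - σ t = (s - t) • (q - p) by simp only [σ]; module, norm_smul,
          Real.norm_eq_abs]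
      rw [dist_eq_norm, Real.dist_eq, id, id]
      nlinarith [abs_nonneg (s - t)]
    refine ne_top_of_le_ne_top ENNReal.one_ne_top (hle.trans ?_)
    simp

theorem rectifiablyJoined_of_isPreconnected {V : Set E} (hV : IsOpen V)
    (hconn : IsPreconnected (V ∩ Metric.sphere 0 1)) {p q : E}
    (hp : p ∈ V ∩ Metric.sphere (0 : E) 1) (hq : q ∈ V ∩ Metric.sphere (0 : E) 1) :
    RectifiablyJoined (V ∩ Metric.sphere 0 1) p q := by
  refine hconn.induction₂ _ ?_ (fun _ _ _ _ _ _ h h' => h.trans h') (fun _ _ _ _ h => h.symm)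
    hp hq
  rintro a ⟨haV, ha⟩
  obtain ⟨r, hr0, hr⟩ := Metric.isOpen_iff.1 hV a haV
  have hpos : 0 < min (1 / 2) (r / 2) := by positivity
  filter_upwards [mem_nhdsWithin_of_mem_nhds (Metric.ball_mem_nhds a hpos),
    self_mem_nhdsWithin] with b hb hb'
  rw [mem_ball_iff_norm, lt_min_iff] at hb
  exact rectifiablyJoined_of_dist_lt hr (by simpa using ha) (by simpa using hb'.2) hb.1.le
    (by linarith [hb.2])

/-- A path `γ` in the sphere lifts to a path in the annular sector over it with prescribed
endpoint radii `a` and `b` in `[0, 2]`, by interpolating the radius linearly. -/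
theorem eVariationOn_radial_lift_le {γ : ℝ → E} (hγ : ∀ t ∈ Set.Icc (0 : ℝ) 1, ‖γ t‖ = 1)
    {a b : ℝ} (ha : a ∈ Set.Icc (0 : ℝ) 2) (hb : b ∈ Set.Icc (0 : ℝ) 2) :
    eVariationOn (fun t => (a + t * (b - a)) • γ t) (Set.Icc 0 1) ≤
      2 * eVariationOn γ (Set.Icc 0 1) + ENNReal.ofReal |a - b| := by
  have hle : eVariationOn (fun t => (a + t * (b - a)) • γ t) (Set.Icc 0 1) ≤
      2 * eVariationOn γ (Set.Icc 0 1) +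
        ENNReal.ofReal |a - b| * eVariationOn (id : ℝ → ℝ) (Set.Icc 0 1) := by
    refine eVariationOn_le_mul_add_mul fun s hs t ht => ?_
    rw [edist_dist, edist_dist, edist_dist, ← ENNReal.ofReal_mul (abs_nonneg _),
      ← ENNReal.ofReal_ofNat 2, ← ENNReal.ofReal_mul zero_le_two,
      ← ENNReal.ofReal_add (by positivity) (by positivity)]
    refine ENNReal.ofReal_le_ofReal ?_
    have hs0 : 0 ≤ a + s * (b - a) := by nlinarith [hs.1, hs.2, ha.1, hb.1]
    have hs2 : a + s * (b - a) ≤ 2 := by nlinarith [hs.1, hs.2, ha.2, hb.2]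
    rw [dist_eq_norm, dist_eq_norm, Real.dist_eq, id, id,
      show (a + s * (b - a)) • γ s - (a + t * (b - a)) • γ t =
        (a + s * (b - a)) • (γ s - γ t) + ((b - a) * (s - t)) • γ t by module]
    refine (norm_add_le _ _).trans ?_
    rw [norm_smul, norm_smul, hγ t ht, mul_one, Real.norm_eq_abs, Real.norm_eq_abs, abs_mul,
      abs_of_nonneg hs0, abs_sub_comm b a]
    gcongr
  refine hle.trans ?_
  gcongr
  simp

end Sphere

theorem stmt_8 (n : ℕ) (hn : 2 ≤ n) (U₀ : Set (EuclideanSpace ℝ (Fin n)))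
    (hsub : U₀ ⊆ Metric.sphere 0 1) (hne : U₀.Nonempty) (hconn : IsConnected U₀)
    (hopen : ∃ V : Set (EuclideanSpace ℝ (Fin n)), IsOpen V ∧ U₀ = V ∩ Metric.sphere 0 1)
    (ε : ℝ) (hε : ε ∈ Set.Ioc (0 : ℝ) 1)
    (U : Set (EuclideanSpace ℝ (Fin n)))
    (hU : U = {z : EuclideanSpace ℝ (Fin n) | 1 < ‖z‖ ∧ ‖z‖ < 1 + ε ∧ ‖z‖⁻¹ • z ∈ U₀}) :
    ∀ x ∈ U, ∀ y ∈ U,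
      max (intrinsicDist U₀ (‖x‖⁻¹ • x) (‖y‖⁻¹ • y)) |‖x‖ - ‖y‖| ≤ intrinsicDist U x y ∧
      intrinsicDist U x y ≤
        4 * max (intrinsicDist U₀ (‖x‖⁻¹ • x) (‖y‖⁻¹ • y)) |‖x‖ - ‖y‖| := by
  obtain ⟨V, hV, rfl⟩ := hopen
  subst hU
  rintro x ⟨hx1, hx2, hxU⟩ y ⟨hy1, hy2, hyU⟩
  have hx0 : ‖x‖ ≠ 0 := by linarith
  have hy0 : ‖y‖ ≠ 0 := by linarith
  have lift : ∀ γ : ℝ → EuclideanSpace ℝ (Fin n), ContinuousOn γ (Set.Icc 0 1) →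
      γ 0 = ‖x‖⁻¹ • x → γ 1 = ‖y‖⁻¹ • y →
      (∀ t ∈ Set.Icc (0 : ℝ) 1, γ t ∈ V ∩ Metric.sphere 0 1) →
      eVariationOn γ (Set.Icc 0 1) ≠ ⊤ →
      ∃ η : ℝ → EuclideanSpace ℝ (Fin n), ContinuousOn η (Set.Icc 0 1) ∧ η 0 = x ∧ η 1 = y ∧
        (∀ t ∈ Set.Icc (0 : ℝ) 1, η t ∈ {z : EuclideanSpace ℝ (Fin n) |
          1 < ‖z‖ ∧ ‖z‖ < 1 + ε ∧ ‖z‖⁻¹ • z ∈ V ∩ Metric.sphere 0 1}) ∧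
        eVariationOn η (Set.Icc 0 1) ≠ ⊤ ∧ (eVariationOn η (Set.Icc 0 1)).toReal ≤
          2 * (eVariationOn γ (Set.Icc 0 1)).toReal + |‖x‖ - ‖y‖| := by
    intro γ hc h0 h1 hU hv
    have hγ : ∀ t ∈ Set.Icc (0 : ℝ) 1, ‖γ t‖ = 1 := fun t ht => by simpa using (hU t ht).2
    have hvar := eVariationOn_radial_lift_le hγ (a := ‖x‖) (b := ‖y‖)
      ⟨by linarith, by linarith [hε.2]⟩ ⟨by linarith, by linarith [hε.2]⟩
    have htop : 2 * eVariationOn γ (Set.Icc 0 1) + ENNReal.ofReal |‖x‖ - ‖y‖| ≠ ⊤ := by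
      finiteness
    refine ⟨fun t => (‖x‖ + t * (‖y‖ - ‖x‖)) • γ t, ?_, ?_, ?_, fun t ht => ?_,
      ne_top_of_le_ne_top htop hvar, ?_⟩
    · have hr : Continuous fun t : ℝ => ‖x‖ + t * (‖y‖ - ‖x‖) := by fun_prop
      exact hr.continuousOn.smul hc
    · simp [h0, smul_smul, hx0]
    · simp [h1, smul_smul, hy0]
    · have hr1 : 1 < ‖x‖ + t * (‖y‖ - ‖x‖) := by
        rcases ht.1.eq_or_lt with rfl | h
        · simpa using hx1
        · nlinarith [ht.2]
      have hr2 : ‖x‖ + t * (‖y‖ - ‖x‖) < 1 + ε := by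
        rcases ht.1.eq_or_lt with rfl | h
        · simpa using hx2
        · nlinarith [ht.2]
      have hr0 : 0 < ‖x‖ + t * (‖y‖ - ‖x‖) := by linarith
      have hn : ‖(‖x‖ + t * (‖y‖ - ‖x‖)) • γ t‖ = ‖x‖ + t * (‖y‖ - ‖x‖) := by
        rw [norm_smul, hγ t ht, mul_one, Real.norm_of_nonneg hr0.le]
      rw [Set.mem_ofPred_eq, hn, smul_smul, inv_mul_cancel₀ hr0.ne', one_smul]
      exact ⟨hr1, hr2, hU t ht⟩
    · refine (ENNReal.toReal_mono htop hvar).trans_eq ?_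
      rw [ENNReal.toReal_add (by finiteness) (by finiteness), ENNReal.toReal_mul,
        ENNReal.toReal_ofReal (abs_nonneg _), ENNReal.toReal_ofNat]
  have hj₀ := rectifiablyJoined_of_isPreconnected hV hconn.isPreconnected hxU hyU
  have hj : RectifiablyJoined {z : EuclideanSpace ℝ (Fin n) |
      1 < ‖z‖ ∧ ‖z‖ < 1 + ε ∧ ‖z‖⁻¹ • z ∈ V ∩ Metric.sphere 0 1} x y := by
    obtain ⟨γ, hc, h0, h1, hU, hv⟩ := hj₀
    obtain ⟨η, ec, e0, e1, eU, ev, -⟩ := lift γ hc h0 h1 hU hv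
    exact ⟨η, ec, e0, e1, eU, ev⟩
  constructor
  · refine le_intrinsicDist hj fun γ hc h0 h1 hU hv => max_le ?_ ?_
    · have hle : eVariationOn (fun t => ‖γ t‖⁻¹ • γ t) (Set.Icc 0 1) ≤
          eVariationOn γ (Set.Icc 0 1) := by
        have h := eVariationOn_le_mul_add_mul (f := fun t => ‖γ t‖⁻¹ • γ t) (g := γ) (h := γ)
          (s := Set.Icc (0 : ℝ) 1) (C := 1) (D := 0) fun s hs t ht => by
            rw [zero_mul, add_zero, one_mul, edist_dist, edist_dist, dist_eq_norm, dist_eq_norm]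
            refine ENNReal.ofReal_le_ofReal ?_
            simpa using mul_norm_inv_norm_smul_sub_le one_pos (hU s hs).1.le (hU t ht).1.le
        simpa using h
      refine (intrinsicDist_le_of_path (γ := fun t => ‖γ t‖⁻¹ • γ t) ?_ (by simp [h0])
        (by simp [h1]) (fun t ht => (hU t ht).2.2) (ne_top_of_le_ne_top hv hle)).trans
        (ENNReal.toReal_mono hv hle)
      exact (hc.norm.inv₀ fun t ht => by linarith [(hU t ht).1]).smul hc
    · have hd := BoundedVariationOn.dist_le hv (Set.left_mem_Icc.2 zero_le_one)
        (Set.right_mem_Icc.2 zero_le_one)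
      rw [h0, h1, dist_eq_norm] at hd
      exact (abs_norm_sub_norm_le x y).trans hd
  · set d := intrinsicDist {z : EuclideanSpace ℝ (Fin n) |
      1 < ‖z‖ ∧ ‖z‖ < 1 + ε ∧ ‖z‖⁻¹ • z ∈ V ∩ Metric.sphere 0 1} x y
    have h : (d - |‖x‖ - ‖y‖|) / 2 ≤
        intrinsicDist (V ∩ Metric.sphere 0 1) (‖x‖⁻¹ • x) (‖y‖⁻¹ • y) := by
      refine le_intrinsicDist hj₀ fun γ hc h0 h1 hU hv => ?_
      obtain ⟨η, ec, e0, e1, eU, ev, hle⟩ := lift γ hc h0 h1 hU hv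
      linarith [intrinsicDist_le_of_path ec e0 e1 eU ev]
    have hm₁ := le_max_left (intrinsicDist (V ∩ Metric.sphere 0 1) (‖x‖⁻¹ • x) (‖y‖⁻¹ • y))
      |‖x‖ - ‖y‖|
    have hm₂ := le_max_right (intrinsicDist (V ∩ Metric.sphere 0 1) (‖x‖⁻¹ • x) (‖y‖⁻¹ • y))
      |‖x‖ - ‖y‖|
    linarith [abs_nonneg (‖x‖ - ‖y‖)]
end

section
/- Fix an integer n ≥ 1 and a constant C₁ > 0. There exists a constant C ≥ 1 depending only on n and C₁ such that the following holds. Let B₁ = ∏_{i=1}^n (−a_i, a_i) and B₂ = ∏_{i=1}^n (−b_i, b_i) be boxes in ℝⁿ with B₁ ⊆ B₂, and suppose that 1/a_i² − 1/b_i² ≤ C₁/(max_j b_j²) for every i. Then for every open connected set U with B₁ ⊆ U ⊆ B₂ and every principal Dirichlet eigenfunction φ_U of U, one has φ_U(x) ≤ C·φ_{B₂}(x) for all x ∈ U, where φ_{B₂}(x) = ∏_{i=1}^n b_i^{−1/2} cos(π x_i/(2 b_i)). -/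
open Real MeasureTheory

noncomputable def dirichletEigenvalue (n : ℕ) (U : Set (EuclideanSpace ℝ (Fin n))) : ℝ :=
  sInf {R : ℝ | ∃ f : EuclideanSpace ℝ (Fin n) → ℝ,
    ContDiff ℝ (⊤ : ℕ∞) f ∧ HasCompactSupport f ∧ tsupport f ⊆ U ∧ f ≠ 0 ∧
    R = (∫ x, ‖fderiv ℝ f x‖ ^ 2) / (∫ x, (f x) ^ 2)}

/-- The Laplacian as the sum of the unmixed second partial derivatives. -/
noncomputable def laplacian {n : ℕ} (φ : EuclideanSpace ℝ (Fin n) → ℝ)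
    (x : EuclideanSpace ℝ (Fin n)) : ℝ :=
  ∑ i : Fin n, fderiv ℝ (fun y => fderiv ℝ φ y (EuclideanSpace.single i 1)) x
    (EuclideanSpace.single i 1)

/-- `φ` is a principal Dirichlet eigenfunction of the nonempty bounded open set `U`. -/
structure IsPrincipalDirichletEigenfunction {n : ℕ} (U : Set (EuclideanSpace ℝ (Fin n)))
    (φ : EuclideanSpace ℝ (Fin n) → ℝ) : Prop where
  continuousOn : ContinuousOn φ (closure U)
  smooth : ContDiffOn ℝ (⊤ : ℕ∞) φ U
  pos : ∀ x ∈ U, 0 < φ x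
  vanishes : ∀ x ∈ frontier U, φ x = 0
  eigenEq : ∀ x ∈ U, laplacian φ x = -(dirichletEigenvalue n U) * φ x
  normalized : (∫ x in U, (φ x) ^ 2) = 1

/-- The open box `∏ i (-a i, a i)` in `ℝⁿ`. -/
def box (n : ℕ) (a : Fin n → ℝ) : Set (EuclideanSpace ℝ (Fin n)) := {x | ∀ i, |x i| < a i}

/-- The principal Dirichlet eigenfunction of the box `∏ i (-a i, a i)`. -/
noncomputable def boxEigenfunction (n : ℕ) (a : Fin n → ℝ)
    (x : EuclideanSpace ℝ (Fin n)) : ℝ :=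
  ∏ i, (1 / Real.sqrt (a i)) * Real.cos (π * x i / (2 * a i))

theorem hasFDerivAt_prod_coord {n : ℕ} {h h' : Fin n → ℝ → ℝ}
    (hh : ∀ i t, HasDerivAt (h i) (h' i t) t) (x : EuclideanSpace ℝ (Fin n)) :
    HasFDerivAt (fun y : EuclideanSpace ℝ (Fin n) => ∏ i, h i (y i))
      (∑ i, (∏ j ∈ Finset.univ.erase i, h j (x j)) •
        (h' i (x i) • (EuclideanSpace.proj i : EuclideanSpace ℝ (Fin n) →L[ℝ] ℝ))) x := by
  refine HasFDerivAt.finsetProd (u := Finset.univ) (x := x)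
    (g := fun i (y : EuclideanSpace ℝ (Fin n)) => h i (y i)) fun i _ => ?_
  exact (hh i (x i)).comp_hasFDerivAt x
    (EuclideanSpace.proj i : EuclideanSpace ℝ (Fin n) →L[ℝ] ℝ).hasFDerivAt

theorem fderiv_prod_coord_single {n : ℕ} {h h' : Fin n → ℝ → ℝ}
    (hh : ∀ i t, HasDerivAt (h i) (h' i t) t) (x : EuclideanSpace ℝ (Fin n)) (i : Fin n) :
    fderiv ℝ (fun y : EuclideanSpace ℝ (Fin n) => ∏ i, h i (y i)) x
      (EuclideanSpace.single i 1) = ∏ j, (Function.update h i (h' i)) j (x j) := by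
  rw [(hasFDerivAt_prod_coord hh x).fderiv, ← Finset.mul_prod_erase _ _ (Finset.mem_univ i)]
  have : ∏ j ∈ Finset.univ.erase i, (Function.update h i (h' i)) j (x j)
      = ∏ j ∈ Finset.univ.erase i, h j (x j) :=
    Finset.prod_congr rfl fun j hj => by
      rw [Function.update_of_ne (Finset.ne_of_mem_erase hj)]
  rw [this]
  simp only [sum_apply, smul_apply, smul_eq_mul, Function.update_self]
  rw [Finset.sum_eq_single i]
  · simp [mul_comm]
  · intro j _ hj
    simp [hj]
  · simp

theorem contDiff_prod_coord {n : ℕ} {m : WithTop ℕ∞} {h : Fin n → ℝ → ℝ}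
    (hh : ∀ i, ContDiff ℝ m (h i)) :
    ContDiff ℝ m (fun y : EuclideanSpace ℝ (Fin n) => ∏ i, h i (y i)) :=
  contDiff_prod fun i _ => (hh i).comp
    (EuclideanSpace.proj i : EuclideanSpace ℝ (Fin n) →L[ℝ] ℝ).contDiff

theorem laplacian_prod_coord {n : ℕ} {h h' : Fin n → ℝ → ℝ} {κ : Fin n → ℝ}
    (hh : ∀ i t, HasDerivAt (h i) (h' i t) t)
    (hh' : ∀ i t, HasDerivAt (h' i) (-κ i * h i t) t) (x : EuclideanSpace ℝ (Fin n)) :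
    laplacian (fun y : EuclideanSpace ℝ (Fin n) => ∏ i, h i (y i)) x
      = -(∑ i, κ i) * ∏ i, h i (x i) := by
  simp only [laplacian, fderiv_prod_coord_single hh]
  rw [← Finset.sum_neg_distrib, Finset.sum_mul]
  refine Finset.sum_congr rfl fun i _ => ?_
  have key : ∀ j t, HasDerivAt (Function.update h i (h' i) j)
      (Function.update h' i (fun t => -κ i * h i t) j t) t := by
    intro j t
    by_cases hj : j = i
    · subst hj; simpa using hh' j t
    · simpa [hj] using hh j t
  rw [fderiv_prod_coord_single key]
  rw [← Finset.mul_prod_erase _ _ (Finset.mem_univ i),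
    ← Finset.mul_prod_erase (a := i) _ (fun j => h j (x j)) (Finset.mem_univ i)]
  have : ∏ j ∈ Finset.univ.erase i, (Function.update (Function.update h i (h' i)) i
      (Function.update h' i (fun t => -κ i * h i t) i)) j (x j)
      = ∏ j ∈ Finset.univ.erase i, h j (x j) :=
    Finset.prod_congr rfl fun j hj => by
      simp [Finset.ne_of_mem_erase hj]
  rw [this]
  simp [mul_assoc]

/-- The `m`-th Dirichlet sine mode of the interval `(-b, b)`, counted from `m = 0`. -/
noncomputable def intervalMode (b : ℝ) (m : ℕ) (t : ℝ) : ℝ :=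
  Real.sin ((m + 1) * (π * (t + b) / (2 * b)))

/-- The frequency of `intervalMode b m`. -/
noncomputable def intervalFreq (b : ℝ) (m : ℕ) : ℝ := (m + 1) * (π / (2 * b))

/-- The product of Dirichlet sine modes on the box `∏ i (-b i, b i)`. -/
noncomputable def boxMode {n : ℕ} (b : Fin n → ℝ) (k : Fin n → ℕ)
    (x : EuclideanSpace ℝ (Fin n)) : ℝ := ∏ i, intervalMode (b i) (k i) (x i)

theorem intervalMode_zero {b : ℝ} (hb : 0 < b) (t : ℝ) :
    intervalMode b 0 t = Real.cos (π * t / (2 * b)) := by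
  rw [intervalMode, ← Real.sin_add_pi_div_two]
  congr 1
  field_simp
  simp

theorem hasDerivAt_intervalMode (b : ℝ) (m : ℕ) (t : ℝ) :
    HasDerivAt (intervalMode b m)
      (intervalFreq b m * Real.cos ((m + 1) * (π * (t + b) / (2 * b)))) t := by
  have h : HasDerivAt (fun t : ℝ => ((m : ℝ) + 1) * (π * (t + b) / (2 * b)))
      (intervalFreq b m) t := by
    have := (((((hasDerivAt_id t).add_const b).const_mul π).div_const (2 * b)).const_mul
      ((m : ℝ) + 1))
    simpa [intervalFreq] using this
  rw [mul_comm]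
  exact h.sin

theorem hasDerivAt_deriv_intervalMode (b : ℝ) (m : ℕ) (t : ℝ) :
    HasDerivAt (fun t => intervalFreq b m * Real.cos ((m + 1) * (π * (t + b) / (2 * b))))
      (-(intervalFreq b m) ^ 2 * intervalMode b m t) t := by
  have h : HasDerivAt (fun t : ℝ => ((m : ℝ) + 1) * (π * (t + b) / (2 * b)))
      (intervalFreq b m) t := by
    have := (((((hasDerivAt_id t).add_const b).const_mul π).div_const (2 * b)).const_mul
      ((m : ℝ) + 1))
    simpa [intervalFreq] using this
  have key := h.cos.const_mul (intervalFreq b m)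
  have e : intervalFreq b m * (-Real.sin ((m + 1) * (π * (t + b) / (2 * b))) * intervalFreq b m)
      = -(intervalFreq b m) ^ 2 * intervalMode b m t := by
    rw [intervalMode]; ring
  rwa [e] at key

theorem contDiff_intervalMode {N : WithTop ℕ∞} (b : ℝ) (m : ℕ) :
    ContDiff ℝ N (intervalMode b m) := by
  unfold intervalMode
  fun_prop

theorem contDiff_boxMode {n : ℕ} {N : WithTop ℕ∞} (b : Fin n → ℝ) (k : Fin n → ℕ) :
    ContDiff ℝ N (boxMode b k) :=
  contDiff_prod_coord fun i => contDiff_intervalMode (b i) (k i)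

theorem laplacian_boxMode {n : ℕ} (b : Fin n → ℝ) (k : Fin n → ℕ)
    (x : EuclideanSpace ℝ (Fin n)) :
    laplacian (boxMode b k) x = -(∑ i, (intervalFreq (b i) (k i)) ^ 2) * boxMode b k x :=
  laplacian_prod_coord (fun i t => hasDerivAt_intervalMode (b i) (k i) t)
    (fun i t => hasDerivAt_deriv_intervalMode (b i) (k i) t) x

theorem abs_sin_nat_mul_le (m : ℕ) (θ : ℝ) : |Real.sin (m * θ)| ≤ m * |Real.sin θ| := by
  induction m with
  | zero => simp
  | succ m ih =>
    have : Real.sin ((m + 1 : ℕ) * θ)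
        = Real.sin (m * θ) * Real.cos θ + Real.cos (m * θ) * Real.sin θ := by
      rw [← Real.sin_add]; push_cast; ring_nf
    rw [this]
    refine (abs_add_le _ _).trans ?_
    rw [abs_mul, abs_mul]
    push_cast
    have h1 := Real.abs_cos_le_one θ
    have h2 := Real.abs_cos_le_one (m * θ)
    nlinarith [abs_nonneg (Real.sin θ), abs_nonneg (Real.sin (m * θ))]

theorem abs_boxMode_le {n : ℕ} (b : Fin n → ℝ) (k : Fin n → ℕ)
    (x : EuclideanSpace ℝ (Fin n)) :
    |boxMode b k x| ≤ (∏ i, ((k i : ℝ) + 1)) * |boxMode b 0 x| := by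
  simp only [boxMode, Finset.abs_prod, ← Finset.prod_mul_distrib]
  refine Finset.prod_le_prod (fun i _ => abs_nonneg _) fun i _ => ?_
  have := abs_sin_nat_mul_le (k i + 1) (π * (x i + b i) / (2 * b i))
  simpa [intervalMode] using this

theorem abs_boxMode_le_one {n : ℕ} (b : Fin n → ℝ) (k : Fin n → ℕ)
    (x : EuclideanSpace ℝ (Fin n)) : |boxMode b k x| ≤ 1 := by
  simp only [boxMode, Finset.abs_prod]
  exact Finset.prod_le_one (fun i _ => abs_nonneg _) fun i _ => Real.abs_sin_le_one _

theorem boxMode_zero_pos {n : ℕ} {b : Fin n → ℝ} {x : EuclideanSpace ℝ (Fin n)}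
    (hx : x ∈ box n b) : 0 < boxMode b 0 x := by
  refine Finset.prod_pos fun i _ => ?_
  have hxi := hx i
  have hb : 0 < b i := (abs_nonneg _).trans_lt hxi
  rw [abs_lt] at hxi
  rw [Pi.zero_apply, intervalMode_zero hb]
  refine Real.cos_pos_of_mem_Ioo ⟨?_, ?_⟩
  · rw [lt_div_iff₀ (by positivity)]; nlinarith [Real.pi_pos]
  · rw [div_lt_iff₀ (by positivity)]; nlinarith [Real.pi_pos]

theorem boxEigenfunction_eq {n : ℕ} {b : Fin n → ℝ} (hb : ∀ i, 0 < b i)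
    (x : EuclideanSpace ℝ (Fin n)) :
    boxEigenfunction n b x = (∏ i, 1 / Real.sqrt (b i)) * boxMode b 0 x := by
  simp only [boxEigenfunction, boxMode, Finset.prod_mul_distrib, Pi.zero_apply]
  congr 1
  exact Finset.prod_congr rfl fun i _ => (intervalMode_zero (hb i) _).symm

/-- The closed box `∏ i [-b i, b i]`. -/
def closedBox (n : ℕ) (b : Fin n → ℝ) : Set (EuclideanSpace ℝ (Fin n)) := {x | ∀ i, |x i| ≤ b i}

theorem box_subset_closedBox {n : ℕ} (b : Fin n → ℝ) : box n b ⊆ closedBox n b :=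
  fun _ hx i => (hx i).le

theorem isOpen_box {n : ℕ} (b : Fin n → ℝ) : IsOpen (box n b) := by
  simp only [box, Set.ofPred_forall]
  exact isOpen_iInter_of_finite fun i => isOpen_lt (by fun_prop) continuous_const

theorem isClosed_closedBox {n : ℕ} (b : Fin n → ℝ) : IsClosed (closedBox n b) := by
  simp only [closedBox, Set.ofPred_forall]
  exact isClosed_iInter fun i => isClosed_le (by fun_prop) continuous_const

theorem isCompact_closedBox {n : ℕ} (b : Fin n → ℝ) : IsCompact (closedBox n b) := by
  refine Metric.isCompact_of_isClosed_isBounded (isClosed_closedBox b) ?_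
  refine isBounded_iff_forall_norm_le.2 ⟨∑ i, |b i|, fun x hx => ?_⟩
  refine abs_le_of_sq_le_sq' ?_ (Finset.sum_nonneg fun i _ => abs_nonneg _) |>.2
  rw [EuclideanSpace.norm_sq_eq]
  refine (Finset.sum_le_sum fun i _ => ?_).trans
    (Finset.sum_sq_le_sq_sum_of_nonneg fun i _ => abs_nonneg (b i))
  rw [Real.norm_eq_abs, sq_abs, sq_abs]
  exact sq_le_sq.2 ((hx i).trans (le_abs_self _))

theorem boxMode_eq_zero {n : ℕ} {b : Fin n → ℝ} (hb : ∀ i, 0 < b i) (k : Fin n → ℕ)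
    {x : EuclideanSpace ℝ (Fin n)} (hx : x ∈ closedBox n b) (hx' : x ∉ box n b) :
    boxMode b k x = 0 := by
  simp only [box, Set.mem_ofPred_eq, not_forall, not_lt] at hx'
  obtain ⟨i, hi⟩ := hx'
  refine Finset.prod_eq_zero (Finset.mem_univ i) ?_
  have hbi := (hb i).ne'
  rcases eq_or_eq_neg_of_abs_eq (le_antisymm (hx i) hi) with h | h
  · rw [intervalMode, h]
    convert Real.sin_nat_mul_pi (k i + 1) using 2
    push_cast
    field_simp
    ring
  · rw [intervalMode, h]
    simp

theorem deriv_deriv_nonpos_of_isLocalMax {f : ℝ → ℝ} {x : ℝ} (h : IsLocalMax f x)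
    (hc : ContinuousAt f x) : deriv (deriv f) x ≤ 0 := by
  by_contra! hpos
  have hmin := isLocalMin_of_deriv_deriv_pos hpos h.deriv_eq_zero hc
  have hconst : f =ᶠ[nhds x] fun _ => f x := by
    filter_upwards [h, hmin] with y h1 h2 using le_antisymm h1 h2
  have : deriv f =ᶠ[nhds x] fun _ => 0 := by
    simpa using hconst.deriv
  rw [this.deriv_eq] at hpos
  simp at hpos

theorem laplacian_nonpos_of_isLocalMax {n : ℕ} {f : EuclideanSpace ℝ (Fin n) → ℝ}
    {x : EuclideanSpace ℝ (Fin n)} (h : IsLocalMax f x) (hf : ContDiffAt ℝ 2 f x) :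
    laplacian f x ≤ 0 := by
  refine Finset.sum_nonpos fun i _ => ?_
  set e : EuclideanSpace ℝ (Fin n) := EuclideanSpace.single i 1
  have hline : ∀ s : ℝ, HasDerivAt (fun s : ℝ => x + s • e) e s := fun s => by
    simpa using ((hasDerivAt_id s).smul_const e).const_add x
  have hcont : Continuous fun s : ℝ => x + s • e := by fun_prop
  have hlim : Filter.Tendsto (fun s : ℝ => x + s • e) (nhds 0) (nhds x) := by
    simpa using hcont.tendsto 0
  have hd : ∀ᶠ s in nhds (0 : ℝ), DifferentiableAt ℝ f (x + s • e) :=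
    hlim.eventually ((hf.eventually (by simp)).mono fun y hy => hy.differentiableAt (by simp))
  have h1 : deriv (fun s : ℝ => f (x + s • e)) =ᶠ[nhds 0] fun s => fderiv ℝ f (x + s • e) e := by
    filter_upwards [hd] with s hs
    exact (hs.hasFDerivAt.comp_hasDerivAt s (hline s)).deriv
  have hg : DifferentiableAt ℝ (fun y => fderiv ℝ f y e) x :=
    ((hf.fderiv_right (m := 1) (by norm_num)).differentiableAt (by simp)).clm_apply
      (differentiableAt_const e)
  have h2 : deriv (deriv fun s : ℝ => f (x + s • e)) 0 = fderiv ℝ (fun y => fderiv ℝ f y e) x e := by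
    rw [h1.deriv_eq]
    have hg' : HasFDerivAt (fun y => fderiv ℝ f y e) (fderiv ℝ (fun y => fderiv ℝ f y e) x)
        (x + (0 : ℝ) • e) := by simpa using hg.hasFDerivAt
    exact (hg'.comp_hasDerivAt 0 (hline 0)).deriv
  rw [← h2]
  refine deriv_deriv_nonpos_of_isLocalMax ?_ ?_
  · have := hlim.eventually h
    simpa [IsLocalMax, IsMaxFilter] using this
  · refine ContinuousAt.comp (g := f) ?_ hcont.continuousAt
    simpa using hf.continuousAt

/-- The weak parabolic maximum principle on a cylinder over a bounded open set. -/
theorem le_of_parabolic_subsolution {n : ℕ} {U : Set (EuclideanSpace ℝ (Fin n))}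
    (hUc : IsCompact (closure U)) (hU : IsOpen U) {T M : ℝ}
    {u u' : ℝ → EuclideanSpace ℝ (Fin n) → ℝ}
    (hcont : ContinuousOn (Function.uncurry u) (Set.Icc 0 T ×ˢ closure U))
    (hsmooth : ∀ t, ∀ x ∈ U, ContDiffAt ℝ 2 (u t) x)
    (hderiv : ∀ t, ∀ x ∈ U, HasDerivAt (fun s => u s x) (u' t x) t)
    (hsub : ∀ t, ∀ x ∈ U, u' t x ≤ laplacian (u t) x)
    (hinit : ∀ x ∈ closure U, u 0 x ≤ M)
    (hbdry : ∀ t ∈ Set.Icc 0 T, ∀ x ∈ frontier U, u t x ≤ M)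
    {t : ℝ} (ht : t ∈ Set.Icc 0 T) {x : EuclideanSpace ℝ (Fin n)} (hx : x ∈ closure U) :
    u t x ≤ M := by
  have key : ∀ η > 0, u t x - η * t ≤ M := by
    intro η hη
    obtain ⟨⟨t₀, x₀⟩, ⟨ht₀, hx₀⟩, hmax⟩ := (isCompact_Icc.prod hUc).exists_isMaxOn
      (f := fun p => Function.uncurry u p - η * p.1) ⟨(t, x), ht, hx⟩
      (hcont.sub (by fun_prop))
    refine (hmax (Set.mk_mem_prod ht hx)).trans ?_
    simp only [Function.uncurry_apply_pair] at ht₀ hx₀ ⊢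
    by_contra! hlt
    have ht₀' : 0 < t₀ := by
      refine ht₀.1.lt_of_ne fun h => ?_
      subst h
      have := hinit x₀ hx₀
      linarith
    have hxU : x₀ ∈ U := by
      rw [closure_eq_self_union_frontier] at hx₀
      refine hx₀.resolve_right fun h => ?_
      have := hbdry t₀ ht₀ x₀ h
      nlinarith
    have hlap : laplacian (u t₀) x₀ ≤ 0 := by
      refine laplacian_nonpos_of_isLocalMax ?_ (hsmooth t₀ x₀ hxU)
      filter_upwards [hU.mem_nhds hxU] with y hy
      have := hmax (Set.mk_mem_prod ht₀ (subset_closure hy))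
      simpa using this
    have hd : 0 ≤ u' t₀ x₀ - η := by
      have h1 : HasDerivAt (fun s => u s x₀ - η * s) (u' t₀ x₀ - η) t₀ := by
        have h2 := (hderiv t₀ x₀ hxU).sub ((hasDerivAt_id t₀).const_mul η)
        rwa [mul_one] at h2
      refine ge_of_tendsto h1.tendsto_slope_zero_left ?_
      have : ∀ᶠ s : ℝ in nhdsWithin 0 (Set.Iio 0), -t₀ < s :=
        nhdsWithin_le_nhds (lt_mem_nhds (by linarith))
      filter_upwards [this, self_mem_nhdsWithin] with s hs hs'
      have hs'' : s < 0 := hs'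
      have := hmax (Set.mk_mem_prod (show t₀ + s ∈ Set.Icc 0 T from
        ⟨by linarith, by linarith [ht₀.2]⟩) hx₀)
      simp only [Function.uncurry_apply_pair, Set.mem_ofPred_eq] at this
      rw [smul_eq_mul]
      exact mul_nonneg_of_nonpos_of_nonpos (inv_nonpos.2 hs''.le) (by linarith)
    linarith [hsub t₀ x₀ hxU]
  have hlim : Filter.Tendsto (fun η : ℝ => u t x - η * t) (nhdsWithin 0 (Set.Ioi 0))
      (nhds (u t x)) := by
    have : Continuous fun η : ℝ => u t x - η * t := by fun_prop
    exact (by simpa using this.tendsto 0 : Filter.Tendsto (fun η : ℝ => u t x - η * t)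
      (nhds 0) (nhds (u t x))).mono_left nhdsWithin_le_nhds
  exact le_of_tendsto hlim (by filter_upwards [self_mem_nhdsWithin] with η hη using key η hη)

theorem setIntegral_box_prod {n : ℕ} {a : Fin n → ℝ} (ha : ∀ i, 0 < a i) (h : Fin n → ℝ → ℝ) :
    ∫ x in box n a, ∏ i, h i (x i) = ∏ i, ∫ t in (-a i)..(a i), h i t := by
  have hpre : box n a = (MeasurableEquiv.toLp 2 (Fin n → ℝ)).symm ⁻¹'
      (Set.univ.pi fun i => Set.Ioo (-a i) (a i)) := by
    ext x
    simp only [box, Set.mem_ofPred_eq, Set.mem_preimage, Set.mem_univ_pi, Set.mem_Ioo, abs_lt]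
    rfl
  rw [hpre]
  have := (EuclideanSpace.volume_preserving_symm_measurableEquiv_toLp (Fin n)).setIntegral_preimage_emb
    (MeasurableEquiv.measurableEmbedding _) (fun y : Fin n → ℝ => ∏ i, h i (y i))
    (Set.univ.pi fun i => Set.Ioo (-a i) (a i))
  refine this.trans ?_
  rw [volume_pi, Measure.restrict_pi_pi, integral_fintype_prod_eq_prod]
  refine Finset.prod_congr rfl fun i _ => ?_
  rw [intervalIntegral.integral_of_le (by linarith [ha i]), integral_Ioc_eq_integral_Ioo]

theorem integral_intervalMode_mul {b : ℝ} (hb : 0 < b) (m l : ℕ) :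
    ∫ t in (-b)..b, intervalMode b m t * intervalMode b l t = if m = l then b else 0 := by
  have hcos : ∀ c : ℤ, ∫ t in (-b)..b, Real.cos (c * (π * (t + b) / (2 * b)))
      = if c = 0 then 2 * b else 0 := by
    intro c
    split_ifs with hc
    · simp [hc]; ring
    · have hc' : (c : ℝ) ≠ 0 := by exact_mod_cast hc
      have hπ := Real.pi_ne_zero
      have h : ∀ t ∈ Set.uIcc (-b) b, HasDerivAt
          (fun t => (2 * b / (c * π)) * Real.sin (c * (π * (t + b) / (2 * b))))
          (Real.cos (c * (π * (t + b) / (2 * b)))) t := by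
        intro t _
        have h1 : HasDerivAt (fun t : ℝ => (c : ℝ) * (π * (t + b) / (2 * b)))
            (c * (π / (2 * b))) t := by
          have := (((((hasDerivAt_id t).add_const b).const_mul π).div_const (2 * b)).const_mul
            (c : ℝ))
          simpa using this
        have h2 := h1.sin.const_mul (2 * b / (c * π))
        have e : 2 * b / (c * π) * (Real.cos (c * (π * (t + b) / (2 * b))) * (c * (π / (2 * b))))
            = Real.cos (c * (π * (t + b) / (2 * b))) := by
          field_simp
        rwa [e] at h2
      rw [intervalIntegral.integral_eq_sub_of_hasDerivAt h
        (Continuous.intervalIntegrable (by fun_prop) _ _)]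
      have e1 : (c : ℝ) * (π * (b + b) / (2 * b)) = c * π := by field_simp; ring
      rw [e1, Real.sin_int_mul_pi]
      simp
  have hprod : ∀ t, intervalMode b m t * intervalMode b l t
      = (1 / 2) * (Real.cos (((m : ℤ) - l : ℤ) * (π * (t + b) / (2 * b)))
        - Real.cos (((m : ℤ) + l + 2 : ℤ) * (π * (t + b) / (2 * b)))) := by
    intro t
    simp only [intervalMode]
    set θ := π * (t + b) / (2 * b)
    have e1 : (((m : ℤ) - l : ℤ) : ℝ) * θ = (m + 1) * θ - (l + 1) * θ := by push_cast; ring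
    have e2 : (((m : ℤ) + l + 2 : ℤ) : ℝ) * θ = (m + 1) * θ + (l + 1) * θ := by push_cast; ring
    rw [e1, e2, Real.cos_sub, Real.cos_add]
    ring
  simp only [hprod]
  rw [intervalIntegral.integral_const_mul, intervalIntegral.integral_sub
    (Continuous.intervalIntegrable (by fun_prop) _ _)
    (Continuous.intervalIntegrable (by fun_prop) _ _), hcos, hcos]
  rw [if_neg (show ¬ ((m : ℤ) + l + 2 = 0) by omega)]
  by_cases h : m = l
  · simp [h]
  · rw [if_neg (by omega), if_neg h]; simp

theorem setIntegral_boxMode_mul {n : ℕ} {b : Fin n → ℝ} (hb : ∀ i, 0 < b i) (k l : Fin n → ℕ) :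
    ∫ x in box n b, boxMode b k x * boxMode b l x = if k = l then ∏ i, b i else 0 := by
  simp only [boxMode, ← Finset.prod_mul_distrib]
  rw [setIntegral_box_prod hb fun i t => intervalMode (b i) (k i) t * intervalMode (b i) (l i) t]
  simp only [fun i => integral_intervalMode_mul (hb i) (k i) (l i)]
  split_ifs with h
  · exact Finset.prod_congr rfl fun i _ => by simp [h]
  · obtain ⟨i, hi⟩ := Function.ne_iff.1 h
    exact Finset.prod_eq_zero (Finset.mem_univ i) (by simp [hi])

/-- Continuous functions on a box supported in it are uniform limits of sums of sine modes. -/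
theorem exists_sum_boxMode_near {n : ℕ} {b : Fin n → ℝ} (hb : ∀ i, 0 < b i)
    {f : EuclideanSpace ℝ (Fin n) → ℝ} (hf : Continuous f) (hf0 : ∀ x, 0 ≤ f x)
    (hfs : ∀ x, x ∉ box n b → f x = 0) {ε : ℝ} (hε : 0 < ε) :
    ∃ c : (Fin n → ℕ) →₀ ℝ, ∀ x ∈ closedBox n b,
      |(∑ k ∈ c.support, c k * boxMode b k x) - f x| ≤ ε := by
  classical
  let K := closedBox n b
  have : CompactSpace K := isCompact_iff_compactSpace.1 (isCompact_closedBox b)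
  let e : (Fin n → ℕ) → C(K, ℝ) := fun k =>
    ⟨fun x => boxMode b k x, (contDiff_boxMode (N := 0) b k).continuous.comp continuous_subtype_val⟩
  let S : Submodule ℝ C(K, ℝ) := Submodule.span ℝ (Set.range e)
  let A : Subalgebra ℝ C(K, ℝ) :=
    { carrier := {g | ∀ s ∈ S, g * s ∈ S}
      mul_mem' := fun {g h} hg hh s hs => by
        rw [mul_assoc]; exact hg _ (hh _ hs)
      add_mem' := fun {g h} hg hh s hs => by
        rw [add_mul]; exact S.add_mem (hg _ hs) (hh _ hs)
      algebraMap_mem' := fun r s hs => by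
        rw [← Algebra.smul_def]; exact S.smul_mem r hs }
  let γ : Fin n → C(K, ℝ) := fun i =>
    ⟨fun x => Real.cos (π * ((x : EuclideanSpace ℝ (Fin n)) i + b i) / (2 * b i)), by fun_prop⟩
  have hγ : ∀ i, γ i ∈ A := by
    intro i s hs
    induction hs using Submodule.span_induction with
    | zero => simp
    | add x y _ _ hx hy => rw [mul_add]; exact S.add_mem hx hy
    | smul r x _ hx => rw [mul_smul_comm]; exact S.smul_mem r hx
    | mem x hx =>
      obtain ⟨k, rfl⟩ := hx
      have hup : ∀ (l : ℕ) (x : K), e (Function.update k i l) x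
          = intervalMode (b i) l ((x : EuclideanSpace ℝ (Fin n)) i)
            * ∏ j ∈ Finset.univ.erase i, intervalMode (b j) (k j) ((x : EuclideanSpace ℝ (Fin n)) j) := by
        intro l x
        change ∏ j, intervalMode (b j) (Function.update k i l j) ((x : EuclideanSpace ℝ (Fin n)) j) = _
        rw [← Finset.mul_prod_erase _ _ (Finset.mem_univ i)]
        congr 1
        · simp
        · exact Finset.prod_congr rfl fun j hj => by
            rw [Function.update_of_ne (Finset.ne_of_mem_erase hj)]
      have hk : ∀ x : K, e k x = intervalMode (b i) (k i) ((x : EuclideanSpace ℝ (Fin n)) i)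
            * ∏ j ∈ Finset.univ.erase i, intervalMode (b j) (k j) ((x : EuclideanSpace ℝ (Fin n)) j) := by
        intro x
        rw [← hup (k i) x, Function.update_eq_self]
      have hmem : ∀ l, e l ∈ S := fun l => Submodule.subset_span ⟨l, rfl⟩
      rcases hki : k i with _ | m
      · have : γ i * e k = (1 / 2 : ℝ) • e (Function.update k i 1) := by
          ext x
          rw [ContinuousMap.mul_apply, ContinuousMap.smul_apply, hup, hk, hki, smul_eq_mul]
          change Real.cos (π * ((x : EuclideanSpace ℝ (Fin n)) i + b i) / (2 * b i)) * _ = _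
          simp only [intervalMode]
          push_cast
          rw [show ((1 : ℝ) + 1) = 2 by norm_num, Real.sin_two_mul, zero_add, one_mul]
          ring
        rw [this]
        exact S.smul_mem _ (hmem _)
      · have : γ i * e k = (1 / 2 : ℝ) • (e (Function.update k i (m + 2))
            + e (Function.update k i m)) := by
          ext x
          rw [ContinuousMap.mul_apply, ContinuousMap.smul_apply, ContinuousMap.add_apply, hup, hup,
            hk, hki, smul_eq_mul]
          change Real.cos (π * ((x : EuclideanSpace ℝ (Fin n)) i + b i) / (2 * b i)) * _ = _
          simp only [intervalMode]
          push_cast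
          set θ := π * ((x : EuclideanSpace ℝ (Fin n)) i + b i) / (2 * b i)
          rw [show ((m : ℝ) + 2 + 1) * θ = (m + 1 + 1) * θ + θ by ring,
            show ((m : ℝ) + 1) * θ = (m + 1 + 1) * θ - θ by ring, Real.sin_add, Real.sin_sub]
          ring
        rw [this]
        exact S.smul_mem _ (S.add_mem (hmem _) (hmem _))
  have hsep : A.SeparatesPoints := by
    intro x y hxy
    have : ∃ i, (x : EuclideanSpace ℝ (Fin n)) i ≠ (y : EuclideanSpace ℝ (Fin n)) i := by
      by_contra! h
      exact hxy (Subtype.ext (PiLp.ext h))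
    obtain ⟨i, hi⟩ := this
    refine ⟨γ i, ⟨γ i, hγ i, rfl⟩, fun h => hi ?_⟩
    have hθ : ∀ z : K, π * ((z : EuclideanSpace ℝ (Fin n)) i + b i) / (2 * b i) ∈ Set.Icc 0 π := by
      intro z
      have hz := abs_le.1 (z.2 i)
      have hbi := hb i
      constructor
      · exact div_nonneg (mul_nonneg Real.pi_pos.le (by linarith)) (by linarith)
      · rw [div_le_iff₀ (by linarith)]; nlinarith [Real.pi_pos]
    have := Real.injOn_cos (hθ x) (hθ y) h
    have hbi := (hb i).ne'
    have hπ := Real.pi_ne_zero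
    field_simp at this
    linarith
  let F : K → ℝ := fun x => max (f x - ε / 2) 0 / boxMode b 0 x
  have hF : Continuous F := by
    rw [continuous_iff_continuousAt]
    intro x
    have hfx : Continuous fun x : K => f x := hf.comp continuous_subtype_val
    by_cases hx : f x < ε / 2
    · have : F =ᶠ[nhds x] fun _ => 0 := by
        filter_upwards [hfx.continuousAt.eventually (gt_mem_nhds hx)] with y hy
        simp only [F]
        rw [max_eq_right (by linarith), zero_div]
      exact continuousAt_const.congr this.symm
    · have hxb : (x : EuclideanSpace ℝ (Fin n)) ∈ box n b := by
        by_contra h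
        exact hx (by rw [hfs _ h]; linarith)
      exact ContinuousAt.div ((hfx.sub continuous_const).max continuous_const).continuousAt
        (e 0).continuous.continuousAt (boxMode_zero_pos hxb).ne'
  obtain ⟨⟨g, hgA⟩, hg⟩ := ContinuousMap.exists_mem_subalgebra_near_continuous_of_separatesPoints
    A hsep F hF (ε / 2) (by linarith)
  have hgS : g * e 0 ∈ S := hgA _ (Submodule.subset_span ⟨0, rfl⟩)
  obtain ⟨c, hc⟩ := Finsupp.mem_span_range_iff_exists_finsupp.1 hgS
  refine ⟨c, fun x hx => ?_⟩
  have hcx : ∑ k ∈ c.support, c k * boxMode b k x = g ⟨x, hx⟩ * boxMode b 0 x := by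
    have := congrArg (fun q : C(K, ℝ) => q ⟨x, hx⟩) hc
    simp only [Finsupp.sum, ContinuousMap.sum_apply, ContinuousMap.smul_apply,
      ContinuousMap.mul_apply, smul_eq_mul] at this
    exact this
  have hFx : F ⟨x, hx⟩ * boxMode b 0 x = max (f x - ε / 2) 0 := by
    by_cases hxb : x ∈ box n b
    · exact div_mul_cancel₀ _ (boxMode_zero_pos hxb).ne'
    · rw [boxMode_eq_zero hb 0 hx hxb, hfs x hxb, max_eq_right (by linarith), mul_zero]
  rw [hcx]
  have h1 : |g ⟨x, hx⟩ * boxMode b 0 x - max (f x - ε / 2) 0| ≤ ε / 2 := by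
    rw [← hFx, ← sub_mul, abs_mul]
    have h2 := hg ⟨x, hx⟩
    have h3 := abs_boxMode_le_one b 0 x
    rw [Real.norm_eq_abs] at h2
    have h4 : |g ⟨x, hx⟩ - F ⟨x, hx⟩| < ε / 2 := h2
    nlinarith [abs_nonneg (boxMode b 0 x), abs_nonneg (g ⟨x, hx⟩ - F ⟨x, hx⟩)]
  have h5 : |max (f x - ε / 2) 0 - f x| ≤ ε / 2 := by
    have := hf0 x
    rcases max_cases (f x - ε / 2) 0 with ⟨h, _⟩ | ⟨h, _⟩ <;> rw [h, abs_le] <;>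
      constructor <;> linarith
  calc _ = |(g ⟨x, hx⟩ * boxMode b 0 x - max (f x - ε / 2) 0) + (max (f x - ε / 2) 0 - f x)| := by
        congr 1; ring
    _ ≤ _ := (abs_add_le _ _).trans (by linarith)

/-- A smooth nonexpansive truncation of the identity, vanishing on `(-∞, ε]`. -/
noncomputable def softThreshold (ε s : ℝ) : ℝ := ∫ r in (0 : ℝ)..s, Real.smoothTransition ((r - ε) / ε)

theorem continuous_smoothTransition_affine (ε : ℝ) :
    Continuous fun r => Real.smoothTransition ((r - ε) / ε) :=
  Real.smoothTransition.continuous.comp (by fun_prop)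

theorem hasDerivAt_softThreshold (ε s : ℝ) :
    HasDerivAt (softThreshold ε) (Real.smoothTransition ((s - ε) / ε)) s :=
  (continuous_smoothTransition_affine ε).integral_hasStrictDerivAt 0 s |>.hasDerivAt

theorem contDiff_softThreshold (ε : ℝ) : ContDiff ℝ (⊤ : ℕ∞) (softThreshold ε) := by
  rw [contDiff_infty_iff_deriv]
  refine ⟨fun s => (hasDerivAt_softThreshold ε s).differentiableAt, ?_⟩
  rw [funext fun s => (hasDerivAt_softThreshold ε s).deriv]
  exact Real.smoothTransition.contDiff.comp (by fun_prop)

theorem softThreshold_eq_zero {ε : ℝ} (hε : 0 < ε) {s : ℝ} (hs : s ≤ ε) :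
    softThreshold ε s = 0 := by
  rw [softThreshold, intervalIntegral.integral_congr (g := fun _ => 0)]
  · simp
  · intro r hr
    refine Real.smoothTransition.zero_of_nonpos (div_nonpos_of_nonpos_of_nonneg ?_ hε.le)
    have := (Set.mem_uIcc.1 hr)
    rcases this with h | h <;> linarith [h.1, h.2]

theorem softThreshold_nonneg {ε s : ℝ} (hs : 0 ≤ s) : 0 ≤ softThreshold ε s :=
  intervalIntegral.integral_nonneg hs fun _ _ => Real.smoothTransition.nonneg _

theorem sub_le_softThreshold {ε : ℝ} (hε : 0 < ε) {s : ℝ} (hs : 2 * ε ≤ s) :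
    s - 2 * ε ≤ softThreshold ε s := by
  have hc := continuous_smoothTransition_affine ε
  rw [softThreshold, ← intervalIntegral.integral_add_adjacent_intervals
    (hc.intervalIntegrable 0 (2 * ε)) (hc.intervalIntegrable (2 * ε) s)]
  have h1 : 0 ≤ ∫ r in (0 : ℝ)..(2 * ε), Real.smoothTransition ((r - ε) / ε) :=
    softThreshold_nonneg (by linarith)
  have h2 : ∫ r in (2 * ε)..s, Real.smoothTransition ((r - ε) / ε) = s - 2 * ε := by
    rw [intervalIntegral.integral_congr (g := fun _ => 1)]
    · simp
    · intro r hr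
      refine Real.smoothTransition.one_of_one_le ?_
      rw [Set.uIcc_of_le hs] at hr
      rw [le_div_iff₀ hε]
      linarith [hr.1]
  linarith

theorem sq_sub_le_softThreshold_sq {ε : ℝ} (hε : 0 < ε) {s : ℝ} (h0 : 0 ≤ s) (h1 : s ≤ 1) :
    s ^ 2 - 4 * ε ≤ softThreshold ε s ^ 2 := by
  rcases le_total (2 * ε) s with h | h
  · have := sub_le_softThreshold hε h
    nlinarith
  · nlinarith [sq_nonneg (softThreshold ε s)]

theorem norm_sq_le_sum_apply_single_sq {n : ℕ} (L : EuclideanSpace ℝ (Fin n) →L[ℝ] ℝ) :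
    ‖L‖ ^ 2 ≤ ∑ i, (L (EuclideanSpace.single i 1)) ^ 2 := by
  have hs : 0 ≤ ∑ i, (L (EuclideanSpace.single i 1)) ^ 2 :=
    Finset.sum_nonneg fun i _ => sq_nonneg _
  rw [← Real.le_sqrt (norm_nonneg _) hs]
  refine L.opNorm_le_bound (Real.sqrt_nonneg _) fun v => ?_
  have hv : L v = ∑ i, L (EuclideanSpace.single i 1) * v i := by
    conv_lhs => rw [← (EuclideanSpace.basisFun (Fin n) ℝ).sum_repr v]
    simp [mul_comm]
  rw [Real.norm_eq_abs, hv]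
  refine Real.abs_le_sqrt (Finset.sum_mul_sq_le_sq_mul_sq _ _ _) |>.trans ?_
  rw [Real.sqrt_mul hs, EuclideanSpace.norm_eq]
  simp

theorem integral_deriv_intervalMode_sq {b : ℝ} (hb : 0 < b) (m : ℕ) :
    ∫ t in (-b)..b, (intervalFreq b m * Real.cos ((m + 1) * (π * (t + b) / (2 * b)))) ^ 2
      = (intervalFreq b m) ^ 2 * b := by
  have h : ∀ t, (intervalFreq b m * Real.cos ((m + 1) * (π * (t + b) / (2 * b)))) ^ 2
      = (intervalFreq b m) ^ 2 * (1 - intervalMode b m t * intervalMode b m t) := by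
    intro t
    rw [mul_pow, Real.cos_sq', intervalMode, sq (Real.sin _)]
  have hc : Continuous (intervalMode b m) := (contDiff_intervalMode (N := 0) b m).continuous
  have hc2 : Continuous fun t => intervalMode b m t * intervalMode b m t := by fun_prop
  simp only [h]
  rw [intervalIntegral.integral_const_mul, intervalIntegral.integral_sub (by simp)
    (hc2.intervalIntegrable _ _), integral_intervalMode_mul hb]
  simp

theorem integrableOn_box {n : ℕ} {b : Fin n → ℝ} {f : EuclideanSpace ℝ (Fin n) → ℝ}
    (hf : Continuous f) : IntegrableOn f (box n b) :=
  (hf.continuousOn.integrableOn_compact (isCompact_closedBox b)).mono_set (box_subset_closedBox b)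

theorem setIntegral_box_one {n : ℕ} {a : Fin n → ℝ} (ha : ∀ i, 0 < a i) :
    ∫ _ in box n a, (1 : ℝ) = ∏ i, 2 * a i := by
  have := setIntegral_box_prod ha fun _ _ => 1
  simp only [Finset.prod_const_one] at this
  rw [this]
  exact Finset.prod_congr rfl fun i _ => by simp; ring

theorem setIntegral_fderiv_boxMode_sq {n : ℕ} {b : Fin n → ℝ} (hb : ∀ i, 0 < b i)
    (k : Fin n → ℕ) (i : Fin n) :
    ∫ x in box n b, (fderiv ℝ (boxMode b k) x (EuclideanSpace.single i 1)) ^ 2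
      = (intervalFreq (b i) (k i)) ^ 2 * ∏ j, b j := by
  have h : ∀ x, fderiv ℝ (boxMode b k) x (EuclideanSpace.single i 1) = _ := fun x =>
    fderiv_prod_coord_single (fun i t => hasDerivAt_intervalMode (b i) (k i) t) x i
  simp only [h, ← Finset.prod_pow]
  rw [setIntegral_box_prod hb fun j t => (Function.update (fun i => intervalMode (b i) (k i)) i
    (fun t => intervalFreq (b i) (k i) * Real.cos ((k i + 1) * (π * (t + b i) / (2 * b i)))) j t) ^ 2,
    ← Finset.mul_prod_erase _ _ (Finset.mem_univ i),
    ← Finset.mul_prod_erase _ b (Finset.mem_univ i), ← mul_assoc]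
  congr 1
  · simp only [Function.update_self]
    exact integral_deriv_intervalMode_sq (hb i) (k i)
  · refine Finset.prod_congr rfl fun j hj => ?_
    rw [Function.update_of_ne (Finset.ne_of_mem_erase hj)]
    simp only [sq]
    rw [integral_intervalMode_mul (hb j), if_pos rfl]

theorem dirichletEigenvalue_mul_le {n : ℕ} {a : Fin n → ℝ} (ha : ∀ i, 0 < a i)
    {U : Set (EuclideanSpace ℝ (Fin n))} (hU : box n a ⊆ U) {ε : ℝ} (hε : 0 < ε)
    (hsmall : 0 < ∏ i, a i - 4 * ε * ∏ i, 2 * a i) :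
    dirichletEigenvalue n U * (∏ i, a i - 4 * ε * ∏ i, 2 * a i)
      ≤ (∑ i, (intervalFreq (a i) 0) ^ 2) * ∏ i, a i := by
  set ψ := boxMode a 0 with hψ
  have hψd : ContDiff ℝ (⊤ : ℕ∞) ψ := contDiff_boxMode a 0
  let g : EuclideanSpace ℝ (Fin n) → ℝ := fun x => softThreshold ε (ψ x)
  have hg : ContDiff ℝ (⊤ : ℕ∞) g := (contDiff_softThreshold ε).comp hψd
  let f : EuclideanSpace ℝ (Fin n) → ℝ := (box n a).indicator g
  let K : Set (EuclideanSpace ℝ (Fin n)) := closedBox n a ∩ {x | ε ≤ ψ x}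
  have hKc : IsCompact K :=
    (isCompact_closedBox a).inter_right (isClosed_le continuous_const hψd.continuous)
  have hKbox : K ⊆ box n a := by
    intro x hx
    by_contra h
    have h1 := boxMode_eq_zero ha 0 hx.1 h
    have h2 : ε ≤ ψ x := hx.2
    rw [hψ, h1] at h2
    linarith
  have hfK : ∀ x, x ∉ K → f x = 0 := by
    intro x hx
    by_cases h : x ∈ box n a
    · refine (Set.indicator_of_mem h g).trans ?_
      refine softThreshold_eq_zero hε ?_
      by_contra! h'
      exact hx ⟨box_subset_closedBox a h, h'.le⟩
    · exact Set.indicator_of_notMem h _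
  have hfg : ∀ x ∈ box n a, f =ᶠ[nhds x] g := fun x hx => by
    filter_upwards [(isOpen_box a).mem_nhds hx] with y hy using Set.indicator_of_mem hy _
  have hf0 : ∀ x, x ∉ K → f =ᶠ[nhds x] fun _ => 0 := fun x hx => by
    filter_upwards [hKc.isClosed.isOpen_compl.mem_nhds hx] with y hy using hfK y hy
  have hsupp : tsupport f ⊆ K := closure_minimal
    (fun x hx => by_contra fun h => hx (hfK x h)) hKc.isClosed
  have hfd : ContDiff ℝ (⊤ : ℕ∞) f := by
    rw [contDiff_iff_contDiffAt]
    intro x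
    by_cases hx : x ∈ K
    · exact hg.contDiffAt.congr_of_eventuallyEq (hfg x (hKbox hx))
    · exact contDiffAt_const.congr_of_eventuallyEq (hf0 x hx)
  have hpart : ∀ i, Continuous fun x => (fderiv ℝ ψ x (EuclideanSpace.single i 1)) ^ 2 := fun i =>
    ((hψd.continuous_fderiv (by simp)).clm_apply continuous_const).pow 2
  have hnum : ∫ x, ‖fderiv ℝ f x‖ ^ 2 ≤ (∑ i, (intervalFreq (a i) 0) ^ 2) * ∏ i, a i := by
    rw [← setIntegral_eq_integral_of_forall_compl_eq_zero (s := box n a)]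
    · calc ∫ x in box n a, ‖fderiv ℝ f x‖ ^ 2
          ≤ ∫ x in box n a, ∑ i, (fderiv ℝ ψ x (EuclideanSpace.single i 1)) ^ 2 := by
            refine setIntegral_mono_on (integrableOn_box ((hfd.continuous_fderiv (by simp)).norm.pow 2))
              (integrableOn_box (continuous_finsetSum _ fun i _ => hpart i))
              (isOpen_box a).measurableSet fun x hx => ?_
            refine le_trans ?_ (norm_sq_le_sum_apply_single_sq _)
            rw [(hfg x hx).fderiv_eq]
            have hd := (hasDerivAt_softThreshold ε (ψ x)).comp_hasFDerivAt x
              (hψd.differentiable (by simp) x).hasFDerivAt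
            have hd' : fderiv ℝ g x = _ := hd.fderiv
            rw [hd', norm_smul]
            refine pow_le_pow_left₀ (by positivity) ?_ 2
            refine mul_le_of_le_one_left (norm_nonneg _) ?_
            rw [Real.norm_eq_abs, abs_of_nonneg (Real.smoothTransition.nonneg _)]
            exact Real.smoothTransition.le_one _
        _ = ∑ i, ∫ x in box n a, (fderiv ℝ ψ x (EuclideanSpace.single i 1)) ^ 2 :=
            integral_finsetSum _ fun i _ => integrableOn_box (hpart i)
        _ = _ := by
            rw [Finset.sum_mul]
            exact Finset.sum_congr rfl fun i _ => setIntegral_fderiv_boxMode_sq ha 0 i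
    · intro x hx
      have h : x ∉ K := fun h => hx (hKbox h)
      rw [(hf0 x h).fderiv_eq]
      simp
  have hψψ : Continuous fun x => ψ x * ψ x := hψd.continuous.mul hψd.continuous
  have hden : ∏ i, a i - 4 * ε * ∏ i, 2 * a i ≤ ∫ x, (f x) ^ 2 := by
    rw [← setIntegral_eq_integral_of_forall_compl_eq_zero (s := box n a)]
    · calc _ = ∫ x in box n a, (ψ x * ψ x - 4 * ε * 1) := by
            rw [integral_sub (integrableOn_box hψψ)
              (integrableOn_box continuous_const), integral_const_mul, setIntegral_box_one ha,
              setIntegral_boxMode_mul ha, if_pos rfl]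
        _ ≤ _ := by
            refine setIntegral_mono_on
              (integrableOn_box (hψψ.sub continuous_const))
              (integrableOn_box (hfd.continuous.pow 2)) (isOpen_box a).measurableSet fun x hx => ?_
            rw [(hfg x hx).eq_of_nhds, mul_one, ← sq]
            exact sq_sub_le_softThreshold_sq hε (boxMode_zero_pos hx).le
              ((le_abs_self _).trans (abs_boxMode_le_one a 0 x))
    · intro x hx
      rw [hfK x fun h => hx (hKbox h)]
      simp
  have hpos := hsmall.trans_le hden
  have hle : dirichletEigenvalue n U ≤ (∫ x, ‖fderiv ℝ f x‖ ^ 2) / ∫ x, (f x) ^ 2 := by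
    refine csInf_le ⟨0, ?_⟩ ⟨f, hfd, hKc.of_isClosed_subset (isClosed_tsupport f) hsupp,
      hsupp.trans (hKbox.trans hU), ?_, rfl⟩
    · rintro R ⟨h, -, -, -, -, rfl⟩
      exact div_nonneg (integral_nonneg fun _ => by positivity)
        (integral_nonneg fun _ => by positivity)
    · intro h
      rw [h] at hpos
      simp at hpos
  have hnn : 0 ≤ (∑ i, (intervalFreq (a i) 0) ^ 2) * ∏ i, a i :=
    mul_nonneg (Finset.sum_nonneg fun i _ => sq_nonneg _) (Finset.prod_nonneg fun i _ => (ha i).le)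
  calc _ ≤ (∑ i, (intervalFreq (a i) 0) ^ 2) * (∏ i, a i) / (∏ i, a i - 4 * ε * ∏ i, 2 * a i)
        * (∏ i, a i - 4 * ε * ∏ i, 2 * a i) :=
        mul_le_mul_of_nonneg_right (hle.trans (div_le_div₀ hnn hnum hsmall hden)) hsmall.le
    _ = _ := div_mul_cancel₀ _ hsmall.ne'

theorem dirichletEigenvalue_le_of_box_subset {n : ℕ} {a : Fin n → ℝ} (ha : ∀ i, 0 < a i)
    {U : Set (EuclideanSpace ℝ (Fin n))} (hU : box n a ⊆ U) :
    dirichletEigenvalue n U ≤ ∑ i, (intervalFreq (a i) 0) ^ 2 := by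
  have hP : 0 < ∏ i, a i := Finset.prod_pos fun i _ => ha i
  have hlim : Filter.Tendsto (fun ε : ℝ => ∏ i, a i - 4 * ε * ∏ i, 2 * a i)
      (nhdsWithin 0 (Set.Ioi 0)) (nhds (∏ i, a i)) := by
    have : Continuous fun ε : ℝ => ∏ i, a i - 4 * ε * ∏ i, 2 * a i := by fun_prop
    have h := this.tendsto 0
    simp only [mul_zero, zero_mul, sub_zero] at h
    exact h.mono_left nhdsWithin_le_nhds
  refine le_of_mul_le_mul_right (le_of_tendsto (hlim.const_mul _) ?_) hP
  filter_upwards [hlim.eventually (lt_mem_nhds hP), self_mem_nhdsWithin] with ε h1 h2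
  exact dirichletEigenvalue_mul_le ha hU h2 h1

theorem laplacian_congr {n : ℕ} {f g : EuclideanSpace ℝ (Fin n) → ℝ} {x : EuclideanSpace ℝ (Fin n)}
    (h : f =ᶠ[nhds x] g) : laplacian f x = laplacian g x := by
  refine Finset.sum_congr rfl fun i _ => ?_
  have : (fun y => fderiv ℝ f y (EuclideanSpace.single i 1)) =ᶠ[nhds x]
      fun y => fderiv ℝ g y (EuclideanSpace.single i 1) :=
    (h.fderiv (𝕜 := ℝ)).mono fun y hy => by simp only [hy]
  rw [this.fderiv_eq]

theorem laplacian_lincomb {n : ℕ} {f g : EuclideanSpace ℝ (Fin n) → ℝ}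
    {x : EuclideanSpace ℝ (Fin n)} (hf : ContDiffAt ℝ 2 f x) (hg : ContDiffAt ℝ 2 g x) (c d : ℝ) :
    laplacian (fun y => c * f y + d * g y) x = c * laplacian f x + d * laplacian g x := by
  simp only [laplacian, Finset.mul_sum, ← Finset.sum_add_distrib]
  refine Finset.sum_congr rfl fun i _ => ?_
  have h1 : (fun y => fderiv ℝ (fun y => c * f y + d * g y) y (EuclideanSpace.single i 1))
      =ᶠ[nhds x] fun y => c * fderiv ℝ f y (EuclideanSpace.single i 1)
        + d * fderiv ℝ g y (EuclideanSpace.single i 1) := by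
    filter_upwards [hf.eventually (by simp), hg.eventually (by simp)] with y hy hy'
    have := ((hy.differentiableAt (by simp)).hasFDerivAt.const_mul c).add
      ((hy'.differentiableAt (by simp)).hasFDerivAt.const_mul d)
    have e : fderiv ℝ (fun y => c * f y + d * g y) y = _ := this.fderiv
    rw [e]
    rfl
  have hdiff : ∀ {q : EuclideanSpace ℝ (Fin n) → ℝ}, ContDiffAt ℝ 2 q x →
      DifferentiableAt ℝ (fun y => fderiv ℝ q y (EuclideanSpace.single i 1)) x := fun hq =>
    ((hq.fderiv_right (m := 1) (by norm_num)).differentiableAt (by simp)).clm_apply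
      (differentiableAt_const _)
  have h2 : fderiv ℝ (fun y => c * fderiv ℝ f y (EuclideanSpace.single i 1)
        + d * fderiv ℝ g y (EuclideanSpace.single i 1)) x = _ :=
    (((hdiff hf).hasFDerivAt.const_mul c).add ((hdiff hg).hasFDerivAt.const_mul d)).fderiv
  rw [h1.fderiv_eq, h2]
  rfl

theorem laplacian_sum_boxMode {n : ℕ} (b : Fin n → ℝ) (s : Finset (Fin n → ℕ))
    (c : (Fin n → ℕ) → ℝ) (x : EuclideanSpace ℝ (Fin n)) :
    laplacian (fun y => ∑ k ∈ s, c k * boxMode b k y) x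
      = ∑ k ∈ s, c k * (-(∑ i, (intervalFreq (b i) (k i)) ^ 2) * boxMode b k x) := by
  classical
  induction s using Finset.induction_on with
  | empty => simp [laplacian]
  | insert k s hk ih =>
    simp only [Finset.sum_insert hk]
    have hs : ContDiff ℝ 2 fun y => ∑ k ∈ s, c k * boxMode b k y :=
      ContDiff.sum fun k _ => contDiff_const.mul (contDiff_boxMode b k)
    have := laplacian_lincomb (contDiff_boxMode (N := 2) b k).contDiffAt (hs.contDiffAt (x := x))
      (c k) 1
    simp only [one_mul] at this
    rw [this, ih, laplacian_boxMode]

/-- The finite sine series `∑ c k * boxMode b k`, evolved by the heat flow for time `t`. -/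
noncomputable def sineHeat {n : ℕ} (b : Fin n → ℝ) (c : (Fin n → ℕ) →₀ ℝ) (t : ℝ)
    (x : EuclideanSpace ℝ (Fin n)) : ℝ :=
  ∑ k ∈ c.support, c k * Real.exp (-(∑ i, (intervalFreq (b i) (k i)) ^ 2) * t) * boxMode b k x

theorem continuous_sineHeat {n : ℕ} (b : Fin n → ℝ) (c : (Fin n → ℕ) →₀ ℝ) :
    Continuous (Function.uncurry (sineHeat b c)) := by
  refine continuous_finsetSum _ fun k _ => ?_
  have := (contDiff_boxMode (N := 0) b k).continuous
  fun_prop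

theorem contDiff_sineHeat {n : ℕ} (b : Fin n → ℝ) (c : (Fin n → ℕ) →₀ ℝ) (t : ℝ) :
    ContDiff ℝ 2 (sineHeat b c t) :=
  ContDiff.sum fun k _ => contDiff_const.mul (contDiff_boxMode b k)

theorem hasDerivAt_sineHeat {n : ℕ} (b : Fin n → ℝ) (c : (Fin n → ℕ) →₀ ℝ) (t : ℝ)
    (x : EuclideanSpace ℝ (Fin n)) :
    HasDerivAt (fun s => sineHeat b c s x) (laplacian (sineHeat b c t) x) t := by
  have e : laplacian (sineHeat b c t) x = _ := laplacian_sum_boxMode b c.support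
    (fun k => c k * Real.exp (-(∑ i, (intervalFreq (b i) (k i)) ^ 2) * t)) x
  rw [e]
  refine HasDerivAt.fun_sum fun k _ => ?_
  have h := (((hasDerivAt_id t).const_mul
    (-(∑ i, (intervalFreq (b i) (k i)) ^ 2))).exp.const_mul (c k)).mul_const (boxMode b k x)
  refine h.congr_deriv ?_
  simp only [id, mul_one]
  ring

theorem sineHeat_eq_zero {n : ℕ} {b : Fin n → ℝ} (hb : ∀ i, 0 < b i) (c : (Fin n → ℕ) →₀ ℝ) (t : ℝ)
    {x : EuclideanSpace ℝ (Fin n)} (hx : x ∈ closedBox n b) (hx' : x ∉ box n b) :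
    sineHeat b c t x = 0 :=
  Finset.sum_eq_zero fun k _ => by rw [boxMode_eq_zero hb k hx hx', mul_zero]

theorem sineHeat_zero {n : ℕ} (b : Fin n → ℝ) (c : (Fin n → ℕ) →₀ ℝ) (x : EuclideanSpace ℝ (Fin n)) :
    sineHeat b c 0 x = ∑ k ∈ c.support, c k * boxMode b k x := by
  simp [sineHeat]

theorem closure_box_subset {n : ℕ} (b : Fin n → ℝ) : closure (box n b) ⊆ closedBox n b :=
  closure_minimal (box_subset_closedBox b) (isClosed_closedBox b)

theorem neg_sineHeat_le {n : ℕ} {b : Fin n → ℝ} (hb : ∀ i, 0 < b i) (c : (Fin n → ℕ) →₀ ℝ)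
    {T ε : ℝ} (hε : 0 ≤ ε) (h0 : ∀ x ∈ closedBox n b, -sineHeat b c 0 x ≤ ε)
    {t : ℝ} (ht : t ∈ Set.Icc 0 T) {x : EuclideanSpace ℝ (Fin n)} (hx : x ∈ closure (box n b)) :
    -sineHeat b c t x ≤ ε := by
  refine le_of_parabolic_subsolution (u := fun t x => -sineHeat b c t x)
    (u' := fun t x => -laplacian (sineHeat b c t) x)
    ((isCompact_closedBox b).of_isClosed_subset isClosed_closure (closure_box_subset b))
    (isOpen_box b) (continuous_sineHeat b c).neg.continuousOn
    (fun t x _ => (contDiff_sineHeat b c t).neg.contDiffAt)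
    (fun t x _ => (hasDerivAt_sineHeat b c t x).neg) (fun t x _ => ?_)
    (fun x hx => h0 x (closure_box_subset b hx)) (fun t _ x hx => ?_) ht hx
  · have := laplacian_lincomb ((contDiff_sineHeat b c t).contDiffAt (x := x))
      ((contDiff_sineHeat b c t).contDiffAt (x := x)) (-1) 0
    simp only [neg_mul, one_mul, zero_mul, add_zero] at this
    exact this.ge
  · rw [(isOpen_box b).frontier_eq] at hx
    rw [sineHeat_eq_zero hb c t (closure_box_subset b hx.1) hx.2]
    simpa using hε

theorem exp_mul_le_sineHeat_add {n : ℕ} {b : Fin n → ℝ} (hb : ∀ i, 0 < b i)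
    {U : Set (EuclideanSpace ℝ (Fin n))} (hU : IsOpen U) (hUb : U ⊆ box n b)
    {φ : EuclideanSpace ℝ (Fin n) → ℝ} (hφ : IsPrincipalDirichletEigenfunction U φ)
    (hφc : Continuous (U.indicator φ)) (c : (Fin n → ℕ) →₀ ℝ)
    {T ε : ℝ} (hε : 0 ≤ ε) (h0 : ∀ x ∈ closedBox n b, |sineHeat b c 0 x - U.indicator φ x| ≤ ε)
    {t : ℝ} (ht : t ∈ Set.Icc 0 T) {x : EuclideanSpace ℝ (Fin n)} (hx : x ∈ U) :
    Real.exp (-dirichletEigenvalue n U * t) * φ x ≤ sineHeat b c t x + ε := by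
  set lam := dirichletEigenvalue n U
  have hUcl : closure U ⊆ closure (box n b) := closure_mono hUb
  have hnn : ∀ x, 0 ≤ U.indicator φ x := fun x =>
    Set.indicator_nonneg (fun y hy => (hφ.pos y hy).le) x
  have hneg : ∀ t ∈ Set.Icc 0 T, ∀ x ∈ closure (box n b), -sineHeat b c t x ≤ ε := fun t ht x hx =>
    neg_sineHeat_le hb c hε (fun x hx => by
      have := abs_le.1 (h0 x hx)
      linarith [this.1, hnn x]) ht hx
  have heq : ∀ x ∈ U, U.indicator φ =ᶠ[nhds x] φ := fun x hx => by
    filter_upwards [hU.mem_nhds hx] with y hy using Set.indicator_of_mem hy _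
  have hsm : ∀ x ∈ U, ContDiffAt ℝ 2 (U.indicator φ) x := fun x hx =>
    ((hφ.smooth.contDiffAt (hU.mem_nhds hx)).of_le
      (by norm_cast)).congr_of_eventuallyEq (heq x hx)
  have key := le_of_parabolic_subsolution (U := U) (T := T) (M := ε)
    (u := fun t x => Real.exp (-lam * t) * U.indicator φ x + (-1) * sineHeat b c t x)
    (u' := fun t x => -lam * Real.exp (-lam * t) * U.indicator φ x
      + (-1) * laplacian (sineHeat b c t) x)
    ((isCompact_closedBox b).of_isClosed_subset isClosed_closure
      (hUcl.trans (closure_box_subset b))) hU ?_ ?_ ?_ ?_ ?_ ?_ ht (subset_closure hx)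
  · simp only [Set.indicator_of_mem hx] at key
    linarith
  · refine Continuous.continuousOn ?_
    have := continuous_sineHeat b c
    exact ((by fun_prop : Continuous fun p : ℝ × EuclideanSpace ℝ (Fin n) =>
      Real.exp (-lam * p.1)).mul (hφc.comp continuous_snd)).add (continuous_const.mul this)
  · exact fun t x hx => (contDiffAt_const.mul (hsm x hx)).add
      (contDiffAt_const.mul (contDiff_sineHeat b c t).contDiffAt)
  · intro t x _
    have h := ((hasDerivAt_id t).const_mul (-lam)).exp.mul_const (U.indicator φ x)
    have h2 := h.add ((hasDerivAt_sineHeat b c t x).const_mul (-1))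
    refine h2.congr_deriv ?_
    simp only [id, mul_one]
    ring
  · intro t x hx
    rw [laplacian_lincomb (hsm x hx) (contDiff_sineHeat b c t).contDiffAt,
      laplacian_congr (heq x hx), hφ.eigenEq x hx, Set.indicator_of_mem hx]
    apply le_of_eq
    ring
  · intro x hx
    have := abs_le.1 (h0 x (closure_box_subset b (hUcl hx)))
    simp only [mul_zero, Real.exp_zero, one_mul]
    linarith [this.1]
  · intro t ht x hx
    have h := hneg t ht x (hUcl (frontier_subset_closure hx))
    rw [hU.frontier_eq] at hx
    rw [Set.indicator_of_notMem hx.2]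
    linarith

theorem abs_coeff_le {n : ℕ} {b : Fin n → ℝ} (hb : ∀ i, 0 < b i)
    {f : EuclideanSpace ℝ (Fin n) → ℝ} (hf : Continuous f)
    (hf1 : ∫ x in box n b, f x ^ 2 = 1) (c : (Fin n → ℕ) →₀ ℝ) {ε : ℝ} (hε : 0 ≤ ε)
    (h0 : ∀ x ∈ closedBox n b, |(∑ k ∈ c.support, c k * boxMode b k x) - f x| ≤ ε)
    {k : Fin n → ℕ} (hk : k ∈ c.support) :
    |c k| * ∏ i, b i ≤ Real.sqrt (∏ i, b i) + ε * ∏ i, 2 * b i := by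
  have hP : 0 < ∏ i, b i := Finset.prod_pos fun i _ => hb i
  set s := Real.sqrt (∏ i, b i)
  have hs0 : 0 < s := Real.sqrt_pos.2 hP
  have hmc : ∀ k, Continuous (boxMode b k) := fun k => (contDiff_boxMode (N := 0) b k).continuous
  have hmm : ∀ l, Continuous fun x => boxMode b l x * boxMode b k x := fun l => (hmc l).mul (hmc k)
  have hsq : Continuous fun x => f x ^ 2 := hf.pow 2
  have h1 : ∫ x in box n b, (∑ l ∈ c.support, c l * boxMode b l x) * boxMode b k x
      = c k * ∏ i, b i := by
    simp only [Finset.sum_mul, mul_assoc]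
    rw [integral_finsetSum _ fun l _ => (integrableOn_box (hmm l)).const_mul (c l)]
    simp only [integral_const_mul, setIntegral_boxMode_mul hb]
    rw [Finset.sum_eq_single k (fun l _ hl => by simp [hl]) fun h => absurd hk h]
    simp
  have hsum : Continuous fun x => (∑ l ∈ c.support, c l * boxMode b l x) * boxMode b k x :=
    (continuous_finsetSum _ fun l _ => continuous_const.mul (hmc l)).mul (hmc k)
  have hI2 := (integrableOn_box (b := b) hsq).const_mul (s / 2)
  have hI3 := (integrableOn_box (b := b) (hmm k)).const_mul (1 / (2 * s))
  have hI4 : IntegrableOn (fun x => s / 2 * f x ^ 2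
      + 1 / (2 * s) * (boxMode b k x * boxMode b k x)) (box n b) := hI2.add hI3
  have hI1 : IntegrableOn (fun _ => ε * (1 : ℝ)) (box n b) := integrableOn_box continuous_const
  calc |c k| * ∏ i, b i = ‖c k * ∏ i, b i‖ := by
        rw [Real.norm_eq_abs, abs_mul, abs_of_pos hP]
    _ ≤ ∫ x in box n b, (ε * 1 + (s / 2 * f x ^ 2
          + 1 / (2 * s) * (boxMode b k x * boxMode b k x))) := by
        rw [← h1]
        refine (norm_integral_le_integral_norm _).trans ?_
        refine setIntegral_mono_on (integrableOn_box hsum.norm) (hI1.add hI4)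
          (isOpen_box b).measurableSet fun x hx => ?_
        have hb1 := h0 x (box_subset_closedBox b hx)
        have hb2 := abs_boxMode_le_one b k x
        set w := ∑ l ∈ c.support, c l * boxMode b l x
        set m := boxMode b k x
        have e : w * m = (w - f x) * m + f x * m := by ring
        rw [e, Real.norm_eq_abs]
        refine (abs_add_le _ _).trans (add_le_add ?_ ?_)
        · rw [abs_mul]
          exact mul_le_mul hb1 hb2 (abs_nonneg _) hε
        · have h3 : s / 2 * f x ^ 2 + 1 / (2 * s) * (m * m) - |f x| * |m|
              = (s * |f x| - |m|) ^ 2 / (2 * s) := by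
            rw [← sq_abs (f x), ← abs_mul_abs_self m]
            field_simp
            ring
          have h4 : 0 ≤ (s * |f x| - |m|) ^ 2 / (2 * s) := by positivity
          rw [abs_mul]
          linarith
    _ = ε * ∏ i, 2 * b i + (s / 2 * 1 + 1 / (2 * s) * ∏ i, b i) := by
        rw [integral_add hI1 hI4, integral_add hI2 hI3, integral_const_mul,
          integral_const_mul, integral_const_mul, setIntegral_box_one hb, hf1,
          setIntegral_boxMode_mul hb, if_pos rfl]
    _ = _ := by
        have : ∏ i, b i = s * s := (Real.mul_self_sqrt hP.le).symm
        rw [this]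
        field_simp
        ring

theorem sum_mode_weight_le {b T : ℝ} (hb : 0 < b) (hT : b ^ 2 ≤ T) (N : ℕ) :
    ∑ m ∈ Finset.range N, ((m : ℝ) + 1) * Real.exp (-(intervalFreq b m) ^ 2 * T)
      ≤ 2 * Real.exp (-(intervalFreq b 0) ^ 2 * T) := by
  set q := (π / (2 * b)) ^ 2 * T with hq
  have hq1 : 1 ≤ q := by
    calc (1 : ℝ) ≤ (π / 2) ^ 2 := by nlinarith [Real.pi_gt_three]
      _ = (π / (2 * b)) ^ 2 * b ^ 2 := by field_simp
      _ ≤ q := mul_le_mul_of_nonneg_left hT (sq_nonneg _)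
  have h0 : -(intervalFreq b 0) ^ 2 * T = -q := by simp [intervalFreq, hq]
  rw [h0]
  have hterm : ∀ m : ℕ, ((m : ℝ) + 1) * Real.exp (-(intervalFreq b m) ^ 2 * T)
      ≤ (1 / 2) ^ m * Real.exp (-q) := by
    intro m
    have e : -(intervalFreq b m) ^ 2 * T = -((m + 1) ^ 2 * q) := by
      simp only [intervalFreq, hq]; ring
    have hm : (0 : ℝ) ≤ m := m.cast_nonneg
    have h1 : Real.exp (-(intervalFreq b m) ^ 2 * T)
        ≤ Real.exp (-m) * Real.exp (-m) * Real.exp (-q) := by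
      rw [e, ← Real.exp_add, ← Real.exp_add, Real.exp_le_exp]
      nlinarith [mul_nonneg hm hm]
    have h2 : (m : ℝ) + 1 ≤ Real.exp m := Real.add_one_le_exp _
    have h3 : Real.exp (-m) ≤ (1 / 2) ^ m := by
      rw [show (-(m : ℝ)) = m * (-1) by ring, Real.exp_nat_mul]
      refine pow_le_pow_left₀ (Real.exp_pos _).le ?_ m
      rw [Real.exp_neg, inv_eq_one_div]
      exact one_div_le_one_div_of_le (by norm_num) (by linarith [Real.add_one_le_exp (1 : ℝ)])
    calc _ ≤ Real.exp m * (Real.exp (-m) * Real.exp (-m) * Real.exp (-q)) :=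
          mul_le_mul h2 h1 (Real.exp_pos _).le (Real.exp_pos _).le
      _ = Real.exp (-m) * Real.exp (-q) := by
          rw [← mul_assoc, ← mul_assoc, ← Real.exp_add]; simp
      _ ≤ _ := mul_le_mul_of_nonneg_right h3 (Real.exp_pos _).le
  refine (Finset.sum_le_sum fun m _ => hterm m).trans ?_
  rw [← Finset.sum_mul]
  exact mul_le_mul_of_nonneg_right (sum_geometric_two_le N) (Real.exp_pos _).le

theorem sum_boxMode_weight_le {n : ℕ} {b : Fin n → ℝ} (hb : ∀ i, 0 < b i) {T : ℝ}
    (hT : ∀ i, b i ^ 2 ≤ T) (s : Finset (Fin n → ℕ)) :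
    ∑ k ∈ s, (∏ i, ((k i : ℝ) + 1)) * Real.exp (-(∑ i, (intervalFreq (b i) (k i)) ^ 2) * T)
      ≤ 2 ^ n * Real.exp (-(∑ i, (intervalFreq (b i) 0) ^ 2) * T) := by
  classical
  have hexp : ∀ k : Fin n → ℕ, Real.exp (-(∑ i, (intervalFreq (b i) (k i)) ^ 2) * T)
      = ∏ i, Real.exp (-(intervalFreq (b i) (k i)) ^ 2 * T) := fun k => by
    rw [← Real.exp_sum, ← Finset.sum_mul, Finset.sum_neg_distrib]
  let N := s.sup (fun k => Finset.univ.sup k) + 1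
  have hsub : s ⊆ Fintype.piFinset fun _ => Finset.range N := by
    intro k hk
    refine Fintype.mem_piFinset.2 fun i => Finset.mem_range.2 (Nat.lt_succ_of_le ?_)
    exact (Finset.le_sup (f := k) (Finset.mem_univ i)).trans
      (Finset.le_sup (f := fun k : Fin n → ℕ => Finset.univ.sup k) hk)
  have h0 := hexp fun _ => 0
  simp only [hexp, ← Finset.prod_mul_distrib]
  calc _ ≤ ∑ k ∈ Fintype.piFinset fun _ => Finset.range N,
        ∏ i, ((k i : ℝ) + 1) * Real.exp (-(intervalFreq (b i) (k i)) ^ 2 * T) :=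
        Finset.sum_le_sum_of_subset_of_nonneg hsub fun k _ _ =>
          Finset.prod_nonneg fun i _ => by positivity
    _ = ∏ i, ∑ m ∈ Finset.range N, ((m : ℝ) + 1) * Real.exp (-(intervalFreq (b i) m) ^ 2 * T) :=
        Finset.sum_prod_piFinset (Finset.range N) fun i (m : ℕ) =>
          ((m : ℝ) + 1) * Real.exp (-(intervalFreq (b i) m) ^ 2 * T)
    _ ≤ ∏ i, 2 * Real.exp (-(intervalFreq (b i) 0) ^ 2 * T) :=
        Finset.prod_le_prod (fun i _ => Finset.sum_nonneg fun m _ => by positivity)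
          fun i _ => sum_mode_weight_le (hb i) (hT i) N
    _ = _ := by
        rw [Finset.prod_mul_distrib]
        simp

/-- Pointwise domination of an eigenfunction on a subdomain by the ground state of the box, with
an explicit constant controlled by the gap between the eigenvalues. -/
theorem eigenfunction_le_boxEigenfunction {n : ℕ} {b : Fin n → ℝ} (hb : ∀ i, 0 < b i)
    {U : Set (EuclideanSpace ℝ (Fin n))} (hU : IsOpen U) (hUb : U ⊆ box n b)
    {φ : EuclideanSpace ℝ (Fin n) → ℝ} (hφ : IsPrincipalDirichletEigenfunction U φ)
    {T : ℝ} (hT0 : 0 ≤ T) (hT : ∀ i, b i ^ 2 ≤ T) {x : EuclideanSpace ℝ (Fin n)} (hx : x ∈ U) :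
    φ x ≤ 2 ^ n * Real.exp ((dirichletEigenvalue n U - ∑ i, (intervalFreq (b i) 0) ^ 2) * T)
      * boxEigenfunction n b x := by
  have hP : 0 < ∏ i, b i := Finset.prod_pos fun i _ => hb i
  set P := ∏ i, b i with hPdef
  set Q := ∏ i, 2 * b i
  set lam := dirichletEigenvalue n U
  set E := Real.exp (-(∑ i, (intervalFreq (b i) 0) ^ 2) * T) with hE
  have hψ := boxMode_zero_pos (hUb hx)
  have hφc : Continuous (U.indicator φ) := continuous_indicator hφ.vanishes hφ.continuousOn
  have hnorm : ∫ x in box n b, (U.indicator φ x) ^ 2 = 1 := by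
    have : (fun x => (U.indicator φ x) ^ 2) = U.indicator fun x => (φ x) ^ 2 := by
      ext y
      by_cases hy : y ∈ U <;> simp [hy]
    rw [this, setIntegral_indicator hU.measurableSet, Set.inter_eq_self_of_subset_right hUb]
    exact hφ.normalized
  have key : ∀ ε > 0, Real.exp (-lam * T) * φ x
      ≤ (Real.sqrt P + ε * Q) / P * (boxMode b 0 x * (2 ^ n * E)) + ε := by
    intro ε hε
    obtain ⟨c, hc⟩ := exists_sum_boxMode_near hb hφc
      (fun x => Set.indicator_nonneg (fun y hy => (hφ.pos y hy).le) x)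
      (fun x hx => Set.indicator_of_notMem (fun h => hx (hUb h)) _) hε
    have h1 := exp_mul_le_sineHeat_add hb hU hUb hφ hφc c (T := T) hε.le
      (fun x hx => by rw [sineHeat_zero]; exact hc x hx) (Set.right_mem_Icc.2 hT0) hx
    refine h1.trans (add_le_add_left ?_ ε)
    have hQ : 0 ≤ Q := Finset.prod_nonneg fun i _ => by linarith [hb i]
    have hA : 0 ≤ (Real.sqrt P + ε * Q) / P := by positivity
    calc sineHeat b c T x ≤ ∑ k ∈ c.support, (Real.sqrt P + ε * Q) / P * (boxMode b 0 x *
          ((∏ i, ((k i : ℝ) + 1)) * Real.exp (-(∑ i, (intervalFreq (b i) (k i)) ^ 2) * T))) := by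
          refine Finset.sum_le_sum fun k hk => (le_abs_self _).trans ?_
          rw [abs_mul, abs_mul, Real.abs_exp]
          have h2 : |c k| ≤ (Real.sqrt P + ε * Q) / P := by
            rw [le_div_iff₀ hP]
            exact abs_coeff_le hb hφc hnorm c hε.le hc hk
          have h3 := abs_boxMode_le b k x
          rw [abs_of_pos hψ] at h3
          calc _ ≤ (Real.sqrt P + ε * Q) / P * Real.exp (-(∑ i, (intervalFreq (b i) (k i)) ^ 2) * T)
                * ((∏ i, ((k i : ℝ) + 1)) * boxMode b 0 x) := by gcongr
            _ = _ := by ring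
      _ ≤ _ := by
          rw [← Finset.mul_sum, ← Finset.mul_sum]
          gcongr
          exact sum_boxMode_weight_le hb hT _
  have hlim : Filter.Tendsto (fun ε : ℝ => (Real.sqrt P + ε * Q) / P
      * (boxMode b 0 x * (2 ^ n * E)) + ε) (nhdsWithin 0 (Set.Ioi 0))
      (nhds (Real.sqrt P / P * (boxMode b 0 x * (2 ^ n * E)))) := by
    have : Continuous fun ε : ℝ => (Real.sqrt P + ε * Q) / P
      * (boxMode b 0 x * (2 ^ n * E)) + ε := by fun_prop
    have h := this.tendsto 0
    simp only [zero_mul, add_zero] at h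
    exact h.mono_left nhdsWithin_le_nhds
  have hle := ge_of_tendsto hlim (by filter_upwards [self_mem_nhdsWithin] with ε hε using key ε hε)
  have hsP : Real.sqrt P / P = ∏ i, 1 / Real.sqrt (b i) := by
    rw [Real.sqrt_div_self, hPdef, Real.sqrt_prod _ fun i _ => (hb i).le]
    simp
  rw [boxEigenfunction_eq hb, ← hsP]
  calc φ x = Real.exp (lam * T) * (Real.exp (-lam * T) * φ x) := by
        rw [← mul_assoc, ← Real.exp_add]; simp
    _ ≤ Real.exp (lam * T) * (Real.sqrt P / P * (boxMode b 0 x * (2 ^ n * E))) :=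
        mul_le_mul_of_nonneg_left hle (Real.exp_pos _).le
    _ = _ := by
        rw [sub_mul, sub_eq_add_neg, Real.exp_add, hE, neg_mul]
        ring

theorem stmt_9 (n : ℕ) (hn : 1 ≤ n) (C₁ : ℝ) (hC₁ : 0 < C₁) :
    ∃ C ≥ (1 : ℝ), ∀ a b : Fin n → ℝ, (∀ i, 0 < a i) → (∀ i, 0 < b i) →
      box n a ⊆ box n b →
      (∀ i j, 1 / (a i) ^ 2 - 1 / (b i) ^ 2 ≤ C₁ / (b j) ^ 2) →
      ∀ U : Set (EuclideanSpace ℝ (Fin n)), IsOpen U → IsConnected U →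
        box n a ⊆ U → U ⊆ box n b →
        ∀ φ : EuclideanSpace ℝ (Fin n) → ℝ, IsPrincipalDirichletEigenfunction U φ →
          ∀ x ∈ U, φ x ≤ C * boxEigenfunction n b x := by
  refine ⟨2 ^ n * Real.exp (n * ((π / 2) ^ 2 * C₁)),
    one_le_mul_of_one_le_of_one_le (one_le_pow₀ one_le_two) (Real.one_le_exp (by positivity)), ?_⟩
  intro a b ha hb _ hab U hU _ haU hUb φ hφ x hx
  have : Nonempty (Fin n) := ⟨⟨0, hn⟩⟩
  obtain ⟨j, hj⟩ := Finite.exists_max b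
  have hbj := hb j
  refine (eigenfunction_le_boxEigenfunction hb hU hUb hφ (sq_nonneg (b j))
    (fun i => pow_le_pow_left₀ (hb i).le (hj i) 2) hx).trans ?_
  have hnn : 0 ≤ boxEigenfunction n b x := by
    rw [boxEigenfunction_eq hb]
    exact mul_nonneg (Finset.prod_nonneg fun i _ => by positivity) (boxMode_zero_pos (hUb hx)).le
  refine mul_le_mul_of_nonneg_right (mul_le_mul_of_nonneg_left (Real.exp_le_exp.2 ?_)
    (by positivity)) hnn
  calc (dirichletEigenvalue n U - ∑ i, (intervalFreq (b i) 0) ^ 2) * b j ^ 2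
      ≤ (∑ i, (intervalFreq (a i) 0) ^ 2 - ∑ i, (intervalFreq (b i) 0) ^ 2) * b j ^ 2 := by
        gcongr
        exact dirichletEigenvalue_le_of_box_subset ha haU
    _ = ∑ i, (π / 2) ^ 2 * ((1 / a i ^ 2 - 1 / b i ^ 2) * b j ^ 2) := by
        rw [← Finset.sum_sub_distrib, Finset.sum_mul]
        refine Finset.sum_congr rfl fun i _ => ?_
        simp only [intervalFreq, Nat.cast_zero, zero_add, one_mul, div_pow, mul_pow]
        have := ha i
        have := hb i
        field_simp
    _ ≤ ∑ _i : Fin n, (π / 2) ^ 2 * C₁ := by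
        gcongr with i
        rw [← le_div_iff₀ (by positivity)]
        exact hab i j
    _ = n * ((π / 2) ^ 2 * C₁) := by simp
end
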